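/- arXiv:2312.12690 — 2 statements merged into one kernel-verified Lean document; each statement's English description precedes it below -/
import Mathlib

section
/- Let ρ > 0 and let s, t, χ be real numbers with 2χ + ρ/√2 ≠ 0. For each positive integer N set n_N = N²/ρ², L_N = N²/ρ² − N (real parameters), δ_N = (n_N + L_N + 1)/(4N), z_N = 1 + s/√(N·δ_N), w_N = 1 + t/√(N·δ_N), λ_N = 1 + χ/√(N·δ_N). Then lim_{N→∞} q̂_{N−1}^{(n_N,L_N)}(z_N·w_N | λ_N²) · (z_N·w_N)^{L_N} · ((1+z_N²)(1+w_N²))^{−(n_N+L_N+1)/2} = (e^{−(s−t)²/2}/2) · ( L_ρ(s+t) + e^{−(s+t+ρ/√2)²/2}/(√(2π)·(2χ + ρ/√2)) ), where L_ρ(x) = (1/√(2π))·∫_{−ρ/√2}^{ρ/√2} e^{−(x−ξ)²/2} dξ, and all powers with real exponents are real powers. -/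
open Finset Filter MeasureTheory

noncomputable section

/-- `q_N^{(n,L)}(y)`. -/
def qS (n L : ℝ) (N : ℕ) (y : ℝ) : ℝ :=
  ∑ k ∈ Finset.range (N + 1),
    Real.Gamma (L + n + 1) / (Real.Gamma ((k : ℝ) + L + 1) * Real.Gamma (n + 1 - k)) * y ^ k

/-- `q̂_N^{(n,L)}(y|x)`. -/
def qhat (n L : ℝ) (N : ℕ) (y x : ℝ) : ℝ :=
  qS n L N y + (1 / (n * x - L)) * (Real.Gamma (L + n + 1) / (Real.Gamma (n + 1) * Real.Gamma L))

/-- `L_ρ(x) = (1/√(2π)) ∫_{−ρ/√2}^{ρ/√2} e^{−(x−ξ)²/2} dξ`. -/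
def Lrho (ρ x : ℝ) : ℝ :=
  (1 / Real.sqrt (2 * Real.pi)) *
    ∫ ξ in (-(ρ / Real.sqrt 2))..(ρ / Real.sqrt 2), Real.exp (-(x - ξ) ^ 2 / 2)

/-- The coefficient of `y ^ k` in `qS n (n - N) _ y`. -/
def inducedCoeff (n : ℝ) (N k : ℕ) : ℝ :=
  Real.Gamma (n - N + n + 1) / (Real.Gamma ((k : ℝ) + (n - N) + 1) * Real.Gamma (n + 1 - k))

lemma inducedCoeff_pos {n : ℝ} {N k : ℕ} (hN : (N : ℝ) < n) (hk : k ≤ N) :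
    0 < inducedCoeff n N k := by
  have hk' : (k : ℝ) ≤ N := by exact_mod_cast hk
  have hk0 : (0 : ℝ) ≤ k := k.cast_nonneg
  have h1 := Real.Gamma_pos_of_pos (show 0 < n - N + n + 1 by linarith)
  have h2 := Real.Gamma_pos_of_pos (show 0 < (k : ℝ) + (n - N) + 1 by linarith)
  have h3 := Real.Gamma_pos_of_pos (show 0 < n + 1 - (k : ℝ) by linarith)
  unfold inducedCoeff
  positivity

lemma inducedCoeff_succ {n : ℝ} {N k : ℕ} (hN : (N : ℝ) < n) (hk : k < N) :
    inducedCoeff n N (k + 1) = inducedCoeff n N k * ((n - k) / (n - N + k + 1)) := by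
  have hk' : (k : ℝ) < N := by exact_mod_cast hk
  have hk0 : (0 : ℝ) ≤ k := k.cast_nonneg
  have h2 := (Real.Gamma_pos_of_pos (show 0 < (k : ℝ) + (n - N) + 1 by linarith)).ne'
  have h3 := (Real.Gamma_pos_of_pos (show 0 < n - (k : ℝ) by linarith)).ne'
  have h4 : n - k ≠ 0 := by linarith
  have h5 : (k : ℝ) + (n - N) + 1 ≠ 0 := by linarith
  have h6 : n - N + k + 1 ≠ 0 := by linarith
  unfold inducedCoeff
  rw [show ((k + 1 : ℕ) : ℝ) + (n - N) + 1 = ((k : ℝ) + (n - N) + 1) + 1 by push_cast; ring,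
    Real.Gamma_add_one h5, show n + 1 - ((k + 1 : ℕ) : ℝ) = n - k by push_cast; ring,
    show n + 1 - (k : ℝ) = (n - k) + 1 by ring, Real.Gamma_add_one h4]
  rw [show (k : ℝ) + (n - N) + 1 = n - N + k + 1 by ring] at h2 ⊢
  field_simp

lemma abs_log_one_sub_add_le {u : ℝ} (h1 : u ≤ 1 / 2) :
    |Real.log (1 - u) + u| ≤ 2 * u ^ 2 := by
  have hpos : 0 < 1 - u := by linarith
  have hup := Real.log_le_sub_one_of_pos hpos
  have hlo := Real.one_sub_inv_le_log_of_pos hpos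
  have hinv : (1 - u)⁻¹ ≤ 1 + u + 2 * u ^ 2 := by
    rw [inv_le_iff_one_le_mul₀ hpos]
    nlinarith [mul_nonneg (sq_nonneg u) (by linarith : 0 ≤ 1 - 2 * u)]
  rw [abs_le]
  constructor <;> nlinarith [sq_nonneg u]

lemma abs_log_inducedCoeff_sub_le {n : ℝ} {N : ℕ} (hn : 0 < n) (hN : (N : ℝ) ≤ n / 2) (k : ℕ)
    (hk : k ≤ N) :
    |Real.log (inducedCoeff n N k) - Real.log (inducedCoeff n N 0) - k * (N - k) / n| ≤
      k * (4 * (N / n) ^ 2) := by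
  have hNn : (N : ℝ) < n := by linarith
  induction k with
  | zero => simp
  | succ k ih =>
    have ih := ih (by omega)
    have hk' : (k : ℝ) + 1 ≤ N := by exact_mod_cast hk
    have hk0 : (0 : ℝ) ≤ k := k.cast_nonneg
    have hstep : ∀ j : ℝ, 0 ≤ j → j ≤ N →
        |Real.log (1 - j / n) + j / n| ≤ 2 * (N / n) ^ 2 := by
      intro j hj0 hjN
      have hj : j / n ≤ N / n := by gcongr
      refine (abs_log_one_sub_add_le (hj.trans ?_)).trans ?_
      · rw [div_le_iff₀ hn]; linarith
      · gcongr
    have ha := hstep k hk0 (by linarith)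
    have hb := hstep (N - 1 - k) (by linarith) (by linarith)
    have hq : (n - k) / (n - N + k + 1) = (1 - k / n) / (1 - (N - 1 - k) / n) := by
      rw [one_sub_div hn.ne', one_sub_div hn.ne', div_div_div_cancel_right₀ hn.ne']
      congr 1; ring
    have h1 : 1 - (k : ℝ) / n ≠ 0 := by
      rw [one_sub_div hn.ne']; exact div_ne_zero (by linarith) hn.ne'
    have h2 : 1 - ((N : ℝ) - 1 - k) / n ≠ 0 := by
      rw [one_sub_div hn.ne']; exact div_ne_zero (by linarith) hn.ne'
    rw [inducedCoeff_succ hNn (by omega), hq,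
      Real.log_mul (inducedCoeff_pos hNn (by omega)).ne' (div_ne_zero h1 h2), Real.log_div h1 h2]
    have hsplit : ((k + 1 : ℕ) : ℝ) * (N - (k + 1 : ℕ)) / n =
        k * (N - k) / n - k / n + (N - 1 - k) / n := by
      push_cast; field_simp; ring
    rw [hsplit]
    push_cast
    rw [abs_le] at *
    constructor <;> linarith [ha.1, ha.2, hb.1, hb.2, ih.1, ih.2]

lemma Gamma_add_half_div_bounds {y : ℝ} (hy : 0 < y) :
    1 / √(y + 1 / 2) ≤ Real.Gamma (y + 1 / 2) / Real.Gamma (y + 1) ∧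
      Real.Gamma (y + 1 / 2) / Real.Gamma (y + 1) ≤ 1 / √y := by
  have hmid : ∀ x : ℝ, 0 < x →
      Real.Gamma (x + 1 / 2) ^ 2 ≤ Real.Gamma x * (x * Real.Gamma x) := by
    intro x hx
    have hG := Real.Gamma_pos_of_pos hx
    have hG1 := Real.Gamma_pos_of_pos (show 0 < x + 1 by linarith)
    have h := Real.Gamma_mul_add_mul_le_rpow_Gamma_mul_rpow_Gamma hx
      (show 0 < x + 1 by linarith) (show (0 : ℝ) < 1 / 2 by norm_num)
      (show (0 : ℝ) < 1 / 2 by norm_num) (by norm_num)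
    rw [show 1 / 2 * x + 1 / 2 * (x + 1) = x + 1 / 2 by ring, ← Real.sqrt_eq_rpow,
      ← Real.sqrt_eq_rpow, ← Real.sqrt_mul hG.le] at h
    have h' := Real.sq_sqrt (mul_pos hG hG1).le
    have h0 := Real.Gamma_pos_of_pos (show 0 < x + 1 / 2 by linarith)
    rw [← Real.Gamma_add_one hx.ne', ← h']
    gcongr
  have hG := Real.Gamma_pos_of_pos hy
  have hGh := Real.Gamma_pos_of_pos (show 0 < y + 1 / 2 by linarith)
  have hG1 := Real.Gamma_add_one hy.ne'
  have h1 := hmid y hy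
  have h2 := hmid (y + 1 / 2) (by linarith)
  rw [show y + 1 / 2 + 1 / 2 = y + 1 by ring] at h2
  have hG1p : 0 < Real.Gamma (y + 1) := Real.Gamma_pos_of_pos (by linarith)
  constructor
  · rw [div_le_div_iff₀ (by positivity) hG1p, one_mul]
    refine abs_le_of_sq_le_sq' ?_ (by positivity) |>.2
    rw [mul_pow, Real.sq_sqrt (by linarith)]
    linarith
  · rw [div_le_div_iff₀ hG1p (by positivity), one_mul]
    refine abs_le_of_sq_le_sq' ?_ (by positivity) |>.2
    rw [mul_pow, Real.sq_sqrt hy.le, hG1]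
    nlinarith

lemma inducedCoeff_half_bounds {n : ℝ} {N : ℕ} (hN : (N : ℝ) < n) :
    1 / √((2 * n - N) / 2 + 1) ≤
        √Real.pi * (2 : ℝ) ^ (-(2 * n - N)) * inducedCoeff n N (N / 2) ∧
      √Real.pi * (2 : ℝ) ^ (-(2 * n - N)) * inducedCoeff n N (N / 2) ≤
        1 / √((2 * n - N) / 2) := by
  have hN0 : (0 : ℝ) ≤ N := N.cast_nonneg
  have hdup := Real.Gamma_mul_Gamma_add_half ((2 * n - N + 1) / 2)
  rw [show (2 * n - N + 1) / 2 + 1 / 2 = (2 * n - N) / 2 + 1 by ring,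
    show 1 - 2 * ((2 * n - N + 1) / 2) = -(2 * n - N) by ring,
    show 2 * ((2 * n - N + 1) / 2) = n - N + n + 1 by ring] at hdup
  have hG1 := Real.Gamma_pos_of_pos (show 0 < (2 * n - N) / 2 + 1 by linarith)
  have hG2 := Real.Gamma_pos_of_pos (show 0 < (2 * n - N + 1) / 2 by linarith)
  obtain ⟨m, hm | hm⟩ := Nat.even_or_odd' N
  · have hm' : (N : ℝ) = 2 * m := by rw [hm]; push_cast; ring
    have hT : √Real.pi * (2 : ℝ) ^ (-(2 * n - N)) * inducedCoeff n N (N / 2) =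
        Real.Gamma ((2 * n - N) / 2 + 1 / 2) / Real.Gamma ((2 * n - N) / 2 + 1) := by
      rw [inducedCoeff, show N / 2 = m by omega,
        show (m : ℝ) + (n - N) + 1 = (2 * n - N) / 2 + 1 by rw [hm']; ring,
        show n + 1 - (m : ℝ) = (2 * n - N) / 2 + 1 by rw [hm']; ring,
        show (2 * n - N) / 2 + 1 / 2 = (2 * n - N + 1) / 2 by ring,
        mul_div_assoc', eq_div_iff hG1.ne', div_mul_eq_mul_div, div_eq_iff (by positivity)]
      linear_combination (-Real.Gamma ((2 * n - N) / 2 + 1)) * hdup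
    rw [hT]
    obtain ⟨h1, h2⟩ := Gamma_add_half_div_bounds (show 0 < (2 * n - N) / 2 by linarith)
    refine ⟨le_trans ?_ h1, h2⟩
    have : 0 < (2 * n - N) / 2 + 1 / 2 := by linarith
    gcongr
    norm_num
  · have hm' : (N : ℝ) = 2 * m + 1 := by rw [hm]; push_cast; ring
    have hG3 := Real.Gamma_pos_of_pos (show 0 < (2 * n - N + 1) / 2 + 1 by linarith)
    have hT : √Real.pi * (2 : ℝ) ^ (-(2 * n - N)) * inducedCoeff n N (N / 2) =
        Real.Gamma ((2 * n - N + 1) / 2 + 1 / 2) / Real.Gamma ((2 * n - N + 1) / 2 + 1) := by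
      rw [inducedCoeff, show N / 2 = m by omega,
        show (m : ℝ) + (n - N) + 1 = (2 * n - N + 1) / 2 by rw [hm']; ring,
        show n + 1 - (m : ℝ) = (2 * n - N + 1) / 2 + 1 by rw [hm']; ring,
        show (2 * n - N + 1) / 2 + 1 / 2 = (2 * n - N) / 2 + 1 by ring,
        mul_div_assoc', eq_div_iff hG3.ne', div_mul_eq_mul_div, div_eq_iff (by positivity)]
      linear_combination (-Real.Gamma ((2 * n - N + 1) / 2 + 1)) * hdup
    rw [hT]
    obtain ⟨h1, h2⟩ := Gamma_add_half_div_bounds (show 0 < (2 * n - N + 1) / 2 by linarith)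
    have hp : 0 < (2 * n - N) / 2 := by linarith
    constructor
    · refine le_trans (le_of_eq ?_) h1
      congr 2; ring
    · refine h2.trans ?_
      gcongr
      linarith

lemma tendsto_mul_log_one_add_of_tendsto_zero {a u : ℕ → ℝ} {c : ℝ}
    (hu : Tendsto u atTop (nhds 0)) (hau : Tendsto (fun N => a N * u N) atTop (nhds c)) :
    Tendsto (fun N => a N * Real.log (1 + u N)) atTop (nhds c) := by
  have hd : HasDerivAt Real.log 1 1 := by simpa using Real.hasDerivAt_log one_ne_zero
  have hcont := continuousAt_dslope_same.2 hd.differentiableAt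
  have h1 : Tendsto (fun N => 1 + u N) atTop (nhds 1) := by simpa using hu.const_add 1
  have h2 := hcont.tendsto.comp h1
  rw [dslope_same, hd.deriv] at h2
  have h3 := hau.mul h2
  rw [mul_one] at h3
  refine h3.congr fun N => ?_
  have := sub_smul_dslope Real.log 1 (1 + u N)
  simp only [add_sub_cancel_left, smul_eq_mul, Real.log_one, sub_zero] at this
  simp only [Function.comp]
  rw [mul_assoc, this]

lemma tendsto_inv_mul_sum_of_continuous {h : ℝ → ℝ} (hh : Continuous h) :
    Tendsto (fun N : ℕ => (N : ℝ)⁻¹ * ∑ k ∈ Finset.range N, h (k / N)) atTop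
      (nhds (∫ x in (0 : ℝ)..1, h x)) := by
  obtain ⟨C, hC⟩ := isCompact_Icc.exists_bound_of_continuousOn (s := Set.Icc (0 : ℝ) 1)
    hh.continuousOn
  have hfloor : ∀ x ∈ Set.Ioc (0 : ℝ) 1, ∀ N : ℕ, (⌊N * x⌋₊ : ℝ) / N ∈ Set.Icc (0 : ℝ) 1 := by
    intro x hx N
    refine ⟨by positivity, div_le_one_of_le₀ ?_ N.cast_nonneg⟩
    refine (Nat.floor_le (by have := hx.1; positivity)).trans ?_
    exact mul_le_of_le_one_right N.cast_nonneg hx.2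
  have hmeas : ∀ N : ℕ, Measurable fun x : ℝ => h ((⌊N * x⌋₊ : ℝ) / N) := by
    intro N
    refine hh.measurable.comp (Measurable.div_const ?_ _)
    exact (measurable_from_top (f := fun n : ℕ => (n : ℝ))).comp
      (Nat.measurable_floor.comp (measurable_const.mul measurable_id))
  have hlim : Tendsto (fun N : ℕ => ∫ x in (0 : ℝ)..1, h ((⌊N * x⌋₊ : ℝ) / N)) atTop
      (nhds (∫ x in (0 : ℝ)..1, h x)) := by
    refine intervalIntegral.tendsto_integral_filter_of_dominated_convergence (fun _ => C)
      (Eventually.of_forall fun N => (hmeas N).aestronglyMeasurable)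
      (Eventually.of_forall fun N => Eventually.of_forall fun x hx => ?_)
      intervalIntegrable_const (Eventually.of_forall fun x hx => ?_)
    · rw [Set.uIoc_of_le zero_le_one] at hx
      exact hC _ (hfloor x hx N)
    · rw [Set.uIoc_of_le zero_le_one] at hx
      refine (hh.tendsto x).comp ?_
      have := (tendsto_nat_floor_mul_div_atTop (R := ℝ) hx.1.le).comp
        tendsto_natCast_atTop_atTop
      refine this.congr fun N => ?_
      simp [mul_comm]
  refine hlim.congr' ?_
  filter_upwards [eventually_gt_atTop 0] with N hN
  have hNpos : (0 : ℝ) < N := by exact_mod_cast hN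
  have hpiece : ∀ k : ℕ, k < N → Set.EqOn (fun x : ℝ => h ((⌊N * x⌋₊ : ℝ) / N))
      (fun _ => h (k / N)) (Set.Ioo ((k : ℝ) / N) ((k + 1 : ℕ) / N)) := by
    intro k _ x hx
    have h1 : (k : ℝ) ≤ N * x := by
      have := (div_lt_iff₀ hNpos).1 hx.1; linarith
    have h2 : N * x < k + 1 := by
      have := (lt_div_iff₀ hNpos).1 hx.2; push_cast at this; linarith
    have : ⌊N * x⌋₊ = k :=
      (Nat.floor_eq_iff (by have := k.cast_nonneg (α := ℝ); linarith)).2 ⟨h1, h2⟩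
    simp only [this]
  have hle : ∀ k : ℕ, (k : ℝ) / N ≤ (k + 1 : ℕ) / N := fun k => by
    push_cast; gcongr; linarith
  have hsum := intervalIntegral.sum_integral_adjacent_intervals (μ := volume)
    (f := fun x : ℝ => h ((⌊N * x⌋₊ : ℝ) / N)) (a := fun k : ℕ => (k : ℝ) / N) (n := N) ?_
  · simp only [Nat.cast_zero, zero_div, div_self hNpos.ne'] at hsum
    rw [← hsum, Finset.mul_sum]
    refine Finset.sum_congr rfl fun k hk => ?_
    rw [intervalIntegral.integral_of_le (hle k), integral_Ioc_eq_integral_Ioo,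
      setIntegral_congr_fun measurableSet_Ioo (hpiece k (Finset.mem_range.1 hk)),
      ← integral_Ioc_eq_integral_Ioo, ← intervalIntegral.integral_of_le (hle k),
      intervalIntegral.integral_const, smul_eq_mul]
    push_cast
    field_simp
    ring
  · intro k hk
    rw [intervalIntegrable_iff_integrableOn_Ioo_of_le (hle k)]
    refine IntegrableOn.congr_fun (integrableOn_const (by simp)) (hpiece k hk).symm
      measurableSet_Ioo

lemma tendsto_inv_mul_sum_exp {g : ℝ → ℝ} (hg : Continuous g) {E : ℕ → ℕ → ℝ} {ε : ℕ → ℝ}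
    (hε : Tendsto ε atTop (nhds 0))
    (hE : ∀ᶠ N in atTop, ∀ k < N, |E N k - g (k / N)| ≤ ε N) :
    Tendsto (fun N : ℕ => (N : ℝ)⁻¹ * ∑ k ∈ Finset.range N, Real.exp (E N k)) atTop
      (nhds (∫ x in (0 : ℝ)..1, Real.exp (g x))) := by
  have hR := tendsto_inv_mul_sum_of_continuous (Real.continuous_exp.comp hg)
  have hup := ((Real.continuous_exp.tendsto 0).comp hε).mul hR
  have hlo := ((Real.continuous_exp.tendsto (-0)).comp hε.neg).mul hR
  rw [neg_zero, Real.exp_zero, one_mul] at hlo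
  rw [Real.exp_zero, one_mul] at hup
  refine tendsto_of_tendsto_of_tendsto_of_le_of_le' hlo hup ?_ ?_
  · filter_upwards [hE] with N hN
    simp only [Function.comp]
    rw [mul_left_comm, Finset.mul_sum]
    gcongr with k hk
    rw [← Real.exp_add, Real.exp_le_exp]
    linarith [(abs_le.1 (hN k (Finset.mem_range.1 hk))).1]
  · filter_upwards [hE] with N hN
    simp only [Function.comp]
    rw [mul_left_comm, Finset.mul_sum _ _ (Real.exp (ε N))]
    gcongr with k hk
    rw [← Real.exp_add, Real.exp_le_exp]
    linarith [(abs_le.1 (hN k (Finset.mem_range.1 hk))).2]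

lemma tendsto_natCast_div_sqrt {ρ : ℝ} (hρ : 0 < ρ) (c : ℝ) :
    Tendsto (fun N : ℕ => (N : ℝ) / √(2 * ((N : ℝ) ^ 2 / ρ ^ 2) - N + c)) atTop
      (nhds (ρ / √2)) := by
  have h0 := tendsto_one_div_atTop_nhds_zero_nat (𝕜 := ℝ)
  have h : Tendsto (fun N : ℕ => (√(2 / ρ ^ 2 - 1 / (N : ℝ) + c * (1 / N) * (1 / N)))⁻¹) atTop
      (nhds (√(2 / ρ ^ 2 - 0 + c * 0 * 0))⁻¹) := by
    refine Tendsto.inv₀ (Real.continuous_sqrt.continuousAt.tendsto.comp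
      ((h0.const_sub _).add ((h0.const_mul c).mul h0))) ?_
    have : 0 < 2 / ρ ^ 2 - 0 + c * 0 * 0 := by simp; positivity
    positivity
  have e : (√(2 / ρ ^ 2 - 0 + c * 0 * 0))⁻¹ = ρ / √2 := by
    rw [show 2 / ρ ^ 2 - 0 + c * 0 * 0 = 2 / ρ ^ 2 by ring, Real.sqrt_div (by norm_num),
      Real.sqrt_sq hρ.le, inv_div]
  rw [e] at h
  refine h.congr' ?_
  filter_upwards [eventually_gt_atTop 0] with N hN
  have hNpos : (0 : ℝ) < N := by exact_mod_cast hN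
  have e2 : 2 * ((N : ℝ) ^ 2 / ρ ^ 2) - N + c =
      (N : ℝ) ^ 2 * (2 / ρ ^ 2 - 1 / (N : ℝ) + c * (1 / N) * (1 / N)) := by
    field_simp
  rw [e2, Real.sqrt_mul (by positivity), Real.sqrt_sq hNpos.le, ← div_div, div_self hNpos.ne']
  exact (one_div _).symm

lemma eventually_natCast_le_sq_div_half {ρ : ℝ} (hρ : 0 < ρ) :
    ∀ᶠ N : ℕ in atTop, (N : ℝ) ≤ (N : ℝ) ^ 2 / ρ ^ 2 / 2 := by
  filter_upwards [eventually_ge_atTop ⌈2 * ρ ^ 2⌉₊] with N hN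
  have h : 2 * ρ ^ 2 ≤ N := (Nat.le_ceil _).trans (by exact_mod_cast hN)
  rw [div_div, le_div_iff₀ (by positivity)]
  nlinarith [N.cast_nonneg (α := ℝ)]

/-- The rescaled point `1 + 2 s / √(n + L + 1)` near the unit circle, with `n = N² / ρ²` and
`L = n - N`. -/
def edgePoint (ρ s : ℝ) (N : ℕ) : ℝ :=
  1 + 2 * s / √(2 * ((N : ℝ) ^ 2 / ρ ^ 2) - N + 1)

lemma tendsto_natCast_mul_edgePoint_sub_one {ρ : ℝ} (hρ : 0 < ρ) (s : ℝ) :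
    Tendsto (fun N : ℕ => (N : ℝ) * (edgePoint ρ s N - 1)) atTop (nhds (√2 * ρ * s)) := by
  have h := (tendsto_natCast_div_sqrt hρ 1).const_mul (2 * s)
  have e : 2 * s * (ρ / √2) = √2 * ρ * s := by
    have h2 : √2 * √2 = 2 := Real.mul_self_sqrt (by norm_num)
    field_simp
    linear_combination (-s) * h2
  rw [e] at h
  refine h.congr fun N => ?_
  rw [edgePoint]
  ring

lemma tendsto_edgePoint {ρ : ℝ} (hρ : 0 < ρ) (s : ℝ) :
    Tendsto (edgePoint ρ s) atTop (nhds 1) := by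
  have h := ((tendsto_natCast_mul_edgePoint_sub_one hρ s).mul
    (tendsto_one_div_atTop_nhds_zero_nat (𝕜 := ℝ))).const_add 1
  rw [mul_zero, add_zero] at h
  refine h.congr' ?_
  filter_upwards [eventually_gt_atTop 0] with N hN
  have hNpos : (0 : ℝ) < N := by exact_mod_cast hN
  field_simp
  ring

lemma tendsto_natCast_mul_log_edgePoint {ρ : ℝ} (hρ : 0 < ρ) (s : ℝ) :
    Tendsto (fun N : ℕ => (N : ℝ) * Real.log (edgePoint ρ s N)) atTop (nhds (√2 * ρ * s)) := by
  have h := tendsto_mul_log_one_add_of_tendsto_zero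
    (by simpa using (tendsto_edgePoint hρ s).sub_const 1)
    (tendsto_natCast_mul_edgePoint_sub_one hρ s)
  simpa using h

lemma tendsto_mul_log_half_add_inv_edgePoint {ρ : ℝ} (hρ : 0 < ρ) (s : ℝ) :
    Tendsto (fun N : ℕ => (2 * ((N : ℝ) ^ 2 / ρ ^ 2) - N + 1) / 2 *
      Real.log ((1 + edgePoint ρ s N ^ 2) / (2 * edgePoint ρ s N))) atTop (nhds (s ^ 2)) := by
  have hz := tendsto_edgePoint hρ s
  have hu : Tendsto (fun N : ℕ => (edgePoint ρ s N - 1) ^ 2 / (2 * edgePoint ρ s N)) atTop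
      (nhds 0) := by
    have := ((hz.sub_const 1).pow 2).div (hz.const_mul 2) (by norm_num)
    rwa [show ((1 : ℝ) - 1) ^ 2 / (2 * 1) = 0 by norm_num] at this
  have hpos : ∀ᶠ N in atTop, 0 < edgePoint ρ s N := hz.eventually (lt_mem_nhds one_pos)
  have hau : Tendsto (fun N : ℕ => (2 * ((N : ℝ) ^ 2 / ρ ^ 2) - N + 1) / 2 *
      ((edgePoint ρ s N - 1) ^ 2 / (2 * edgePoint ρ s N))) atTop (nhds (s ^ 2)) := by
    have h := hz.inv₀ one_ne_zero |>.const_mul (s ^ 2)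
    rw [inv_one, mul_one] at h
    refine h.congr' ?_
    filter_upwards [hpos, eventually_natCast_le_sq_div_half hρ] with N hN hle
    have hK : 0 < 2 * ((N : ℝ) ^ 2 / ρ ^ 2) - N + 1 := by
      linarith [N.cast_nonneg (α := ℝ)]
    have e : (edgePoint ρ s N - 1) ^ 2 = 4 * s ^ 2 / (2 * ((N : ℝ) ^ 2 / ρ ^ 2) - N + 1) := by
      rw [edgePoint, add_sub_cancel_left, div_pow, Real.sq_sqrt hK.le]
      ring
    rw [e]
    generalize 2 * ((N : ℝ) ^ 2 / ρ ^ 2) - N + 1 = K at *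
    field_simp
    norm_num
  refine (tendsto_mul_log_one_add_of_tendsto_zero hu hau).congr' ?_
  filter_upwards [hpos] with N hN
  congr 2
  field_simp
  ring

lemma tendsto_weight {ρ : ℝ} (hρ : 0 < ρ) (s t : ℝ) :
    Tendsto (fun N : ℕ => (2 : ℝ) ^ (2 * ((N : ℝ) ^ 2 / ρ ^ 2) - N) *
      ((edgePoint ρ s N * edgePoint ρ t N) ^ ((N : ℝ) ^ 2 / ρ ^ 2 - N) *
        ((1 + edgePoint ρ s N ^ 2) * (1 + edgePoint ρ t N ^ 2)) ^
          (-(2 * ((N : ℝ) ^ 2 / ρ ^ 2) - N + 1) / 2))) atTop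
      (nhds (Real.exp (-(√2 * ρ * (s + t)) / 2 - s ^ 2 - t ^ 2) / 2)) := by
  have hz := tendsto_edgePoint hρ s
  have hw := tendsto_edgePoint hρ t
  have hl := (tendsto_natCast_mul_log_edgePoint hρ s).add (tendsto_natCast_mul_log_edgePoint hρ t)
  have hl0 := (hz.log one_ne_zero).add (hw.log one_ne_zero)
  have h := (((hl.add hl0).div_const 2).neg.sub (tendsto_mul_log_half_add_inv_edgePoint hρ s)).sub
    (tendsto_mul_log_half_add_inv_edgePoint hρ t)
  have h' := ((Real.continuous_exp.tendsto _).comp h).div_const 2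
  rw [show -((√2 * ρ * s + √2 * ρ * t + (Real.log 1 + Real.log 1)) / 2) - s ^ 2 - t ^ 2 =
    -(√2 * ρ * (s + t)) / 2 - s ^ 2 - t ^ 2 by rw [Real.log_one]; ring] at h'
  refine h'.congr' ?_
  filter_upwards [hz.eventually (lt_mem_nhds one_pos), hw.eventually (lt_mem_nhds one_pos)]
    with N hzN hwN
  simp only [Function.comp]
  generalize edgePoint ρ s N = z at *
  generalize edgePoint ρ t N = w at *
  generalize (N : ℝ) ^ 2 / ρ ^ 2 = n at *
  have hz2 : 0 < 1 + z ^ 2 := by positivity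
  have hw2 : 0 < 1 + w ^ 2 := by positivity
  rw [Real.rpow_def_of_pos two_pos, Real.rpow_def_of_pos (mul_pos hzN hwN),
    Real.rpow_def_of_pos (mul_pos hz2 hw2), ← Real.exp_add, ← Real.exp_add,
    Real.log_mul hzN.ne' hwN.ne', Real.log_mul hz2.ne' hw2.ne',
    Real.log_div hz2.ne' (by positivity), Real.log_div hw2.ne' (by positivity),
    Real.log_mul two_ne_zero hzN.ne', Real.log_mul two_ne_zero hwN.ne', div_eq_mul_inv,
    show (2 : ℝ)⁻¹ = Real.exp (-Real.log 2) by rw [Real.exp_neg, Real.exp_log two_pos],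
    ← Real.exp_add]
  congr 1
  ring

lemma tendsto_inducedCoeff_half {ρ : ℝ} (hρ : 0 < ρ) :
    Tendsto (fun N : ℕ => (N : ℝ) * (√Real.pi * (2 : ℝ) ^ (-(2 * ((N : ℝ) ^ 2 / ρ ^ 2) - N)) *
      inducedCoeff ((N : ℝ) ^ 2 / ρ ^ 2) N (N / 2))) atTop (nhds ρ) := by
  have hb : ∀ c : ℝ, Tendsto (fun N : ℕ => (N : ℝ) *
      (1 / √((2 * ((N : ℝ) ^ 2 / ρ ^ 2) - N + c) / 2))) atTop (nhds ρ) := by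
    intro c
    have h := (tendsto_natCast_div_sqrt hρ c).const_mul (√2)
    rw [show √2 * (ρ / √2) = ρ by field_simp] at h
    refine h.congr fun N => ?_
    rw [Real.sqrt_div' _ (by norm_num), one_div_div]
    ring
  have hlo := hb 2
  have hup := hb 0
  refine tendsto_of_tendsto_of_tendsto_of_le_of_le' hlo hup ?_ ?_
  all_goals
    filter_upwards [eventually_natCast_le_sq_div_half hρ, eventually_gt_atTop 0] with N hN hN0
    have hNpos : (0 : ℝ) < N := by exact_mod_cast hN0
    obtain ⟨h1, h2⟩ := inducedCoeff_half_bounds (n := (N : ℝ) ^ 2 / ρ ^ 2) (N := N) (by linarith)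
  · refine mul_le_mul_of_nonneg_left (le_trans (le_of_eq ?_) h1) hNpos.le
    congr 2; ring
  · refine mul_le_mul_of_nonneg_left (h2.trans (le_of_eq ?_)) hNpos.le
    congr 2; ring

lemma eventually_abs_log_inducedCoeff_sub_le {ρ : ℝ} (hρ : 0 < ρ) :
    ∀ᶠ N : ℕ in atTop, ∀ k ≤ N,
      |Real.log (inducedCoeff ((N : ℝ) ^ 2 / ρ ^ 2) N k) -
        Real.log (inducedCoeff ((N : ℝ) ^ 2 / ρ ^ 2) N 0) -
          ρ ^ 2 * ((k : ℝ) / N * (1 - (k : ℝ) / N))| ≤ 4 * ρ ^ 4 * (1 / N) := by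
  filter_upwards [eventually_natCast_le_sq_div_half hρ, eventually_gt_atTop 0] with N hN hN0 k hk
  have hNpos : (0 : ℝ) < N := by exact_mod_cast hN0
  have hk' : (k : ℝ) ≤ N := by exact_mod_cast hk
  have h := abs_log_inducedCoeff_sub_le (n := (N : ℝ) ^ 2 / ρ ^ 2) (by positivity) hN k hk
  rw [show (k : ℝ) * (N - k) / ((N : ℝ) ^ 2 / ρ ^ 2) =
    ρ ^ 2 * ((k : ℝ) / N * (1 - (k : ℝ) / N)) by field_simp] at h
  refine h.trans ?_
  calc (k : ℝ) * (4 * (N / ((N : ℝ) ^ 2 / ρ ^ 2)) ^ 2)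
      ≤ N * (4 * (N / ((N : ℝ) ^ 2 / ρ ^ 2)) ^ 2) := by gcongr
    _ = 4 * ρ ^ 4 * (1 / N) := by field_simp

lemma tendsto_natHalf_div : Tendsto (fun N : ℕ => ((N / 2 : ℕ) : ℝ) / N) atTop (nhds (1 / 2)) := by
  have h := (tendsto_nat_floor_mul_div_atTop (R := ℝ) (a := 1 / 2) (by norm_num)).comp
    tendsto_natCast_atTop_atTop
  refine h.congr fun N => ?_
  simp only [Function.comp]
  rw [show (1 / 2 : ℝ) * N = (N : ℝ) / (2 : ℕ) by push_cast; ring, Nat.floor_div_natCast,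
    Nat.floor_natCast]

lemma tendsto_inducedCoeff_zero {ρ : ℝ} (hρ : 0 < ρ) :
    Tendsto (fun N : ℕ => (N : ℝ) * ((2 : ℝ) ^ (-(2 * ((N : ℝ) ^ 2 / ρ ^ 2) - N)) *
      inducedCoeff ((N : ℝ) ^ 2 / ρ ^ 2) N 0)) atTop
      (nhds (ρ / √Real.pi * Real.exp (-(ρ ^ 2 / 4)))) := by
  have hx := tendsto_natHalf_div
  have hd : Tendsto (fun N : ℕ => Real.log (inducedCoeff ((N : ℝ) ^ 2 / ρ ^ 2) N (N / 2)) -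
        Real.log (inducedCoeff ((N : ℝ) ^ 2 / ρ ^ 2) N 0)) atTop (nhds (ρ ^ 2 / 4)) := by
    have h1 : Tendsto (fun N : ℕ => ρ ^ 2 * (((N / 2 : ℕ) : ℝ) / N * (1 - ((N / 2 : ℕ) : ℝ) / N)))
        atTop (nhds (ρ ^ 2 / 4)) := by
      have := (hx.mul (hx.const_sub 1)).const_mul (ρ ^ 2)
      rwa [show ρ ^ 2 * (1 / 2 * (1 - 1 / 2)) = ρ ^ 2 / 4 by ring] at this
    have h2 : Tendsto (fun N : ℕ => 4 * ρ ^ 4 * (1 / (N : ℝ))) atTop (nhds 0) := by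
      simpa using (tendsto_one_div_atTop_nhds_zero_nat (𝕜 := ℝ)).const_mul (4 * ρ ^ 4)
    have h3 := (squeeze_zero_norm' (by
      filter_upwards [eventually_abs_log_inducedCoeff_sub_le hρ] with N hN
      exact hN (N / 2) (Nat.div_le_self _ _)) h2).add h1
    simpa using h3
  have h := ((tendsto_inducedCoeff_half hρ).mul
    ((Real.continuous_exp.tendsto _).comp hd.neg)).div_const (√Real.pi)
  rw [mul_div_right_comm] at h
  refine h.congr' ?_
  filter_upwards [eventually_natCast_le_sq_div_half hρ, eventually_gt_atTop 0] with N hN hN0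
  have hNpos : (0 : ℝ) < N := by exact_mod_cast hN0
  have hp := inducedCoeff_pos (n := (N : ℝ) ^ 2 / ρ ^ 2) (N := N) (k := N / 2) (by linarith)
    (Nat.div_le_self _ _)
  have hp0 := inducedCoeff_pos (n := (N : ℝ) ^ 2 / ρ ^ 2) (N := N) (k := 0) (by linarith)
    (Nat.zero_le _)
  simp only [Function.comp]
  rw [neg_sub (Real.log _), Real.exp_sub, Real.exp_log hp, Real.exp_log hp0]
  have : √Real.pi ≠ 0 := by positivity
  field_simp

lemma tendsto_inv_mul_sum_inducedCoeff {ρ : ℝ} (hρ : 0 < ρ) (s t : ℝ) :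
    Tendsto (fun N : ℕ => (N : ℝ)⁻¹ * ∑ k ∈ Finset.range N,
      inducedCoeff ((N : ℝ) ^ 2 / ρ ^ 2) N k / inducedCoeff ((N : ℝ) ^ 2 / ρ ^ 2) N 0 *
        (edgePoint ρ s N * edgePoint ρ t N) ^ k) atTop
      (nhds (∫ x in (0 : ℝ)..1, Real.exp (ρ ^ 2 * (x * (1 - x)) + x * (√2 * ρ * (s + t))))) := by
  have hz := tendsto_edgePoint hρ s
  have hw := tendsto_edgePoint hρ t
  have hpos : ∀ᶠ N in atTop, 0 < edgePoint ρ s N ∧ 0 < edgePoint ρ t N :=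
    (hz.eventually (lt_mem_nhds one_pos)).and (hw.eventually (lt_mem_nhds one_pos))
  have hl : Tendsto (fun N : ℕ => (N : ℝ) * Real.log (edgePoint ρ s N * edgePoint ρ t N)) atTop
      (nhds (√2 * ρ * (s + t))) := by
    have := (tendsto_natCast_mul_log_edgePoint hρ s).add (tendsto_natCast_mul_log_edgePoint hρ t)
    rw [← mul_add] at this
    refine this.congr' ?_
    filter_upwards [hpos] with N hN
    rw [Real.log_mul hN.1.ne' hN.2.ne', mul_add]
  have hε : Tendsto (fun N : ℕ => 4 * ρ ^ 4 * (1 / (N : ℝ)) +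
      |(N : ℝ) * Real.log (edgePoint ρ s N * edgePoint ρ t N) - √2 * ρ * (s + t)|) atTop
      (nhds 0) := by
    have := ((tendsto_one_div_atTop_nhds_zero_nat (𝕜 := ℝ)).const_mul (4 * ρ ^ 4)).add
      (hl.sub_const (√2 * ρ * (s + t))).abs
    simpa using this
  have h := tendsto_inv_mul_sum_exp
    (g := fun x => ρ ^ 2 * (x * (1 - x)) + x * (√2 * ρ * (s + t))) (by fun_prop)
    (E := fun N k => Real.log (inducedCoeff ((N : ℝ) ^ 2 / ρ ^ 2) N k) -
      Real.log (inducedCoeff ((N : ℝ) ^ 2 / ρ ^ 2) N 0) +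
        k * Real.log (edgePoint ρ s N * edgePoint ρ t N)) hε ?_
  · refine h.congr' ?_
    filter_upwards [hpos, eventually_natCast_le_sq_div_half hρ, eventually_gt_atTop 0]
      with N hN hle hN0
    have hNpos : (0 : ℝ) < N := by exact_mod_cast hN0
    congr 1
    refine Finset.sum_congr rfl fun k hk => ?_
    rw [Real.exp_add, Real.exp_sub, Real.exp_log, Real.exp_log, Real.exp_nat_mul,
      Real.exp_log (mul_pos hN.1 hN.2)]
    · exact inducedCoeff_pos (by linarith) (Nat.zero_le _)
    · exact inducedCoeff_pos (by linarith) (Finset.mem_range.1 hk).le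
  · filter_upwards [eventually_abs_log_inducedCoeff_sub_le hρ, eventually_gt_atTop 0]
      with N hN hN0 k hk
    have hNpos : (0 : ℝ) < N := by exact_mod_cast hN0
    have hk' : (k : ℝ) ≤ N := by exact_mod_cast hk.le
    have hrw : Real.log (inducedCoeff ((N : ℝ) ^ 2 / ρ ^ 2) N k) -
        Real.log (inducedCoeff ((N : ℝ) ^ 2 / ρ ^ 2) N 0) +
          k * Real.log (edgePoint ρ s N * edgePoint ρ t N) -
        (ρ ^ 2 * ((k : ℝ) / N * (1 - (k : ℝ) / N)) + (k : ℝ) / N * (√2 * ρ * (s + t))) =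
        (Real.log (inducedCoeff ((N : ℝ) ^ 2 / ρ ^ 2) N k) -
          Real.log (inducedCoeff ((N : ℝ) ^ 2 / ρ ^ 2) N 0) -
            ρ ^ 2 * ((k : ℝ) / N * (1 - (k : ℝ) / N))) +
        (k : ℝ) / N * (N * Real.log (edgePoint ρ s N * edgePoint ρ t N) - √2 * ρ * (s + t)) := by
      linear_combination (-Real.log (edgePoint ρ s N * edgePoint ρ t N)) *
        div_mul_cancel₀ (k : ℝ) hNpos.ne'
    rw [hrw]
    refine (abs_add_le _ _).trans (add_le_add (hN k hk.le) ?_)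
    rw [abs_mul, abs_of_nonneg (by positivity : (0 : ℝ) ≤ k / N)]
    exact mul_le_of_le_one_left (abs_nonneg _) (div_le_one_of_le₀ hk' hNpos.le)

lemma tendsto_correction {ρ : ℝ} (hρ : 0 < ρ) {χ : ℝ} (hχ : 2 * χ + ρ / √2 ≠ 0) :
    Tendsto (fun N : ℕ => (N : ℝ)⁻¹ * (((N : ℝ) ^ 2 / ρ ^ 2 - N) /
      ((N : ℝ) ^ 2 / ρ ^ 2 * edgePoint ρ χ N ^ 2 - ((N : ℝ) ^ 2 / ρ ^ 2 - N)))) atTop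
      (nhds (1 / (ρ * √2 * (2 * χ + ρ / √2)))) := by
  have h0 := tendsto_one_div_atTop_nhds_zero_nat (𝕜 := ℝ)
  have hnum := h0.const_sub (1 / ρ ^ 2)
  have hden := (((tendsto_natCast_mul_edgePoint_sub_one hρ χ).mul
    ((tendsto_edgePoint hρ χ).add_const 1)).div_const (ρ ^ 2)).add_const 1
  have e : √2 * ρ * χ * (1 + 1) / ρ ^ 2 + 1 = √2 / ρ * (2 * χ + ρ / √2) := by
    field_simp
    ring
  rw [e] at hden
  have h := hnum.div hden (mul_ne_zero (by positivity) hχ)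
  rw [show (1 / ρ ^ 2 - 0) / (√2 / ρ * (2 * χ + ρ / √2)) = 1 / (ρ * √2 * (2 * χ + ρ / √2)) by
    rw [sub_zero, div_div]; congr 1; field_simp] at h
  refine h.congr' ?_
  filter_upwards [eventually_gt_atTop 0] with N hN0
  have hNpos : (0 : ℝ) < N := by exact_mod_cast hN0
  simp only [Pi.div_apply]
  generalize edgePoint ρ χ N = z
  have e1 : (N : ℝ) ^ 2 / ρ ^ 2 - N = (N : ℝ) ^ 2 * (1 / ρ ^ 2 - 1 / N) := by field_simp
  have e2 : (N : ℝ) ^ 2 / ρ ^ 2 * z ^ 2 - (N : ℝ) ^ 2 * (1 / ρ ^ 2 - 1 / N) =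
      N * (N * (z - 1) * (z + 1) / ρ ^ 2 + 1) := by
    field_simp
    ring
  rw [e1, e2, pow_two (N : ℝ), mul_assoc (N : ℝ) N, mul_div_mul_left _ _ hNpos.ne',
    mul_div_assoc (N : ℝ), inv_mul_cancel_left₀ hNpos.ne']

lemma Lrho_eq_integral_unitInterval {ρ : ℝ} (hρ : 0 < ρ) (S : ℝ) :
    Lrho ρ S = ρ / √Real.pi * Real.exp (-(S ^ 2 / 2) - ρ ^ 2 / 4 - √2 * ρ * S / 2) *
      ∫ x in (0 : ℝ)..1, Real.exp (ρ ^ 2 * (x * (1 - x)) + x * (√2 * ρ * S)) := by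
  have hsq : √2 * √2 = 2 := Real.mul_self_sqrt (by norm_num)
  have hc : √2 * ρ ≠ 0 := by positivity
  have h := intervalIntegral.integral_comp_mul_sub (a := 0) (b := 1)
    (fun ξ => Real.exp (-(S - ξ) ^ 2 / 2)) hc (ρ / √2)
  have e1 : √2 * ρ * 1 - ρ / √2 = ρ / √2 := by field_simp; linear_combination hsq
  rw [mul_zero, zero_sub, e1, smul_eq_mul, eq_comm, inv_mul_eq_iff_eq_mul₀ hc] at h
  have e2 : ∀ x : ℝ, Real.exp (-(S - (√2 * ρ * x - ρ / √2)) ^ 2 / 2) =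
      Real.exp (-(S ^ 2 / 2) - ρ ^ 2 / 4 - √2 * ρ * S / 2) *
        Real.exp (ρ ^ 2 * (x * (1 - x)) + x * (√2 * ρ * S)) := by
    intro x
    rw [← Real.exp_add, show ρ / √2 = √2 * ρ / 2 by field_simp; linear_combination (-1) * hsq]
    congr 1
    linear_combination (-(ρ ^ 2 * (x - 1 / 2) ^ 2 / 2)) * hsq
  rw [Lrho, h]
  simp only [e2]
  rw [intervalIntegral.integral_const_mul, Real.sqrt_mul (by norm_num)]
  field_simp

lemma qhat_eq_inducedCoeff_mul {n : ℝ} {N : ℕ} (hN0 : 0 < N) (hN : (N : ℝ) < n) (y x : ℝ) :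
    qhat n (n - N) (N - 1) y x = N * inducedCoeff n N 0 *
      ((N : ℝ)⁻¹ * ∑ k ∈ Finset.range N, inducedCoeff n N k / inducedCoeff n N 0 * y ^ k +
        (N : ℝ)⁻¹ * ((n - N) / (n * x - (n - N)))) := by
  have hNpos : (0 : ℝ) < N := by exact_mod_cast hN0
  have hp := (inducedCoeff_pos hN (Nat.zero_le _)).ne'
  have hL : n - N ≠ 0 := by linarith
  have hsum : ∑ k ∈ Finset.range N, inducedCoeff n N k / inducedCoeff n N 0 * y ^ k =
      (inducedCoeff n N 0)⁻¹ * qS n (n - N) (N - 1) y := by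
    rw [qS, Nat.sub_add_cancel hN0, Finset.mul_sum]
    refine Finset.sum_congr rfl fun k _ => ?_
    rw [div_eq_inv_mul, mul_assoc, inducedCoeff.eq_def n N k]
  have hT : Real.Gamma (n - N + n + 1) / (Real.Gamma (n + 1) * Real.Gamma (n - N)) =
      inducedCoeff n N 0 * (n - N) := by
    rw [inducedCoeff, Nat.cast_zero, zero_add, sub_zero, Real.Gamma_add_one hL]
    field_simp
  rw [qhat, hsum, hT]
  linear_combination (-(N : ℝ) * (N : ℝ)⁻¹ * qS n (n - N) (N - 1) y) * mul_inv_cancel₀ hp +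
    (-qS n (n - N) (N - 1) y - inducedCoeff n N 0 * (n - N) / (n * x - (n - N))) *
      mul_inv_cancel₀ hNpos.ne'

/-- Weakly non-unitary scaling limit of the weighted truncated sum `q̂ · ω̂` arising
from the induced spherical unitary ensemble. -/
theorem qhat_weakly_nonunitary_limit (ρ : ℝ) (hρ : 0 < ρ) (s t χ : ℝ)
    (hχ : 2 * χ + ρ / Real.sqrt 2 ≠ 0) :
    Tendsto (fun N : ℕ =>
      let nN : ℝ := (N : ℝ) ^ 2 / ρ ^ 2
      let LN : ℝ := (N : ℝ) ^ 2 / ρ ^ 2 - N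
      let δN : ℝ := (nN + LN + 1) / (4 * N)
      let zN : ℝ := 1 + s / Real.sqrt (N * δN)
      let wN : ℝ := 1 + t / Real.sqrt (N * δN)
      let lamN : ℝ := 1 + χ / Real.sqrt (N * δN)
      qhat nN LN (N - 1) (zN * wN) (lamN ^ 2) * (zN * wN) ^ LN *
        ((1 + zN ^ 2) * (1 + wN ^ 2)) ^ (-(nN + LN + 1) / 2))
      atTop
      (nhds ((Real.exp (-(s - t) ^ 2 / 2) / 2) *
        (Lrho ρ (s + t) +
          Real.exp (-(s + t + ρ / Real.sqrt 2) ^ 2 / 2) /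
            (Real.sqrt (2 * Real.pi) * (2 * χ + ρ / Real.sqrt 2))))) := by
  have hB := (tendsto_inducedCoeff_zero hρ).mul (tendsto_weight hρ s t)
  have h := hB.mul ((tendsto_inv_mul_sum_inducedCoeff hρ s t).add (tendsto_correction hρ hχ))
  have hlim : ρ / √Real.pi * Real.exp (-(ρ ^ 2 / 4)) *
        (Real.exp (-(√2 * ρ * (s + t)) / 2 - s ^ 2 - t ^ 2) / 2) *
      ((∫ x in (0 : ℝ)..1, Real.exp (ρ ^ 2 * (x * (1 - x)) + x * (√2 * ρ * (s + t)))) +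
        1 / (ρ * √2 * (2 * χ + ρ / √2))) =
      (Real.exp (-(s - t) ^ 2 / 2) / 2) * (Lrho ρ (s + t) +
        Real.exp (-(s + t + ρ / √2) ^ 2 / 2) / (√(2 * Real.pi) * (2 * χ + ρ / √2))) := by
    have hsq : √2 * √2 = 2 := Real.mul_self_sqrt (by norm_num)
    have e1 : Real.exp (-(s + t + ρ / √2) ^ 2 / 2) =
        Real.exp (-((s + t) ^ 2 / 2) - ρ ^ 2 / 4 - √2 * ρ * (s + t) / 2) := by
      rw [show ρ / √2 = √2 * ρ / 2 by field_simp; linear_combination (-1) * hsq]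
      congr 1
      linear_combination (-(ρ ^ 2 / 8)) * hsq
    have e2 : Real.exp (-(ρ ^ 2 / 4)) * Real.exp (-(√2 * ρ * (s + t)) / 2 - s ^ 2 - t ^ 2) =
        Real.exp (-(s - t) ^ 2 / 2) *
          Real.exp (-((s + t) ^ 2 / 2) - ρ ^ 2 / 4 - √2 * ρ * (s + t) / 2) := by
      rw [← Real.exp_add, ← Real.exp_add]
      congr 1
      ring
    rw [Lrho_eq_integral_unitInterval hρ, e1, Real.sqrt_mul (by norm_num)]
    generalize (∫ x in (0 : ℝ)..1, Real.exp (ρ ^ 2 * (x * (1 - x)) + x * (√2 * ρ * (s + t)))) = I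
    generalize 2 * χ + ρ / √2 = D at *
    have e3 : ρ / √Real.pi * (1 / (ρ * √2 * D)) = 1 / (√2 * √Real.pi * D) := by
      have : √Real.pi ≠ 0 := by positivity
      field_simp
    linear_combination (ρ / √Real.pi * (I + 1 / (ρ * √2 * D)) / 2) * e2 +
      (Real.exp (-(s - t) ^ 2 / 2) / 2 *
        Real.exp (-((s + t) ^ 2 / 2) - ρ ^ 2 / 4 - √2 * ρ * (s + t) / 2)) * e3
  rw [hlim] at h
  refine h.congr' ?_
  filter_upwards [eventually_natCast_le_sq_div_half hρ, eventually_gt_atTop 0] with N hN hN0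
  have hNpos : (0 : ℝ) < N := by exact_mod_cast hN0
  have hpoint : ∀ a : ℝ, 1 + a / √(N * (((N : ℝ) ^ 2 / ρ ^ 2 + ((N : ℝ) ^ 2 / ρ ^ 2 - N) + 1) /
      (4 * N))) = edgePoint ρ a N := by
    intro a
    rw [edgePoint, show N * (((N : ℝ) ^ 2 / ρ ^ 2 + ((N : ℝ) ^ 2 / ρ ^ 2 - N) + 1) / (4 * N)) =
      (2 * ((N : ℝ) ^ 2 / ρ ^ 2) - N + 1) / 2 ^ 2 by field_simp; ring,
      Real.sqrt_div' _ (by norm_num), Real.sqrt_sq (by norm_num), div_div_eq_mul_div, mul_comm a]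
  simp only [hpoint]
  rw [show -((N : ℝ) ^ 2 / ρ ^ 2 + ((N : ℝ) ^ 2 / ρ ^ 2 - N) + 1) / 2 =
    -(2 * ((N : ℝ) ^ 2 / ρ ^ 2) - N + 1) / 2 by ring]
  have hq := qhat_eq_inducedCoeff_mul hN0 (n := (N : ℝ) ^ 2 / ρ ^ 2) (by linarith)
    (edgePoint ρ s N * edgePoint ρ t N) (edgePoint ρ χ N ^ 2)
  rw [hq]
  have h2 : (2 : ℝ) ^ (-(2 * ((N : ℝ) ^ 2 / ρ ^ 2) - N)) *
      (2 : ℝ) ^ (2 * ((N : ℝ) ^ 2 / ρ ^ 2) - N) = 1 := by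
    rw [← Real.rpow_add two_pos, neg_add_cancel, Real.rpow_zero]
  generalize (2 : ℝ) ^ (-(2 * ((N : ℝ) ^ 2 / ρ ^ 2) - N)) = P at *
  generalize (2 : ℝ) ^ (2 * ((N : ℝ) ^ 2 / ρ ^ 2) - N) = Q at *
  generalize (edgePoint ρ s N * edgePoint ρ t N) ^ ((N : ℝ) ^ 2 / ρ ^ 2 - N) = Y at *
  linear_combination (N * inducedCoeff ((N : ℝ) ^ 2 / ρ ^ 2) N 0 * Y *
    ((1 + edgePoint ρ s N ^ 2) * (1 + edgePoint ρ t N ^ 2)) ^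
      (-(2 * ((N : ℝ) ^ 2 / ρ ^ 2) - N + 1) / 2) *
    ((N : ℝ)⁻¹ * ∑ k ∈ Finset.range N,
        inducedCoeff ((N : ℝ) ^ 2 / ρ ^ 2) N k / inducedCoeff ((N : ℝ) ^ 2 / ρ ^ 2) N 0 *
          (edgePoint ρ s N * edgePoint ρ t N) ^ k +
        (N : ℝ)⁻¹ * (((N : ℝ) ^ 2 / ρ ^ 2 - N) / ((N : ℝ) ^ 2 / ρ ^ 2 * edgePoint ρ χ N ^ 2 -
          ((N : ℝ) ^ 2 / ρ ^ 2 - N))))) * h2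
end
end

section
/- Let a ≥ 0 and b > 0 be real numbers (with the convention 1/Γ(0) = 0 when a = 0), and set p = √((a+1)/b). For each positive integer N set L_N = a·N, n_N = (b+1)·N, δ_N = (n_N + L_N + 1)/(N·(1+p²)²). Fix a real number χ and set λ_N = p + χ/√(N·δ_N). Then lim_{N→∞} N^{−1/2} · ĝ_N^{(n_N,L_N)}(λ_N²) · λ_N^{2L_N} · (1+λ_N²)^{−(n_N+L_N+1)} = √((a+1)·b/(2π·(a+b+1))) · 𝓕(2χ), where 𝓕(x) = e^{−x²/2} − √(2π)·x·F(x), F(x) = (1/2)·erfc(x/√2), erfc(x) = (2/√π)·∫_x^∞ e^{−u²} du, and all powers with real exponents are real powers. -/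
open Finset Filter MeasureTheory

noncomputable section

/-- `ĝ_N^{(n,L)}(x)`. -/
def ghat (n L : ℝ) (N : ℕ) (x : ℝ) : ℝ :=
  (L + (N : ℝ) + 1) * qhat n L (N + 1) x x - x * (n - N - 1) * qhat n L N x x

/-- The complementary error function `erfc(x) = (2/√π) ∫_x^∞ e^{−u²} du`. -/
def erfc (x : ℝ) : ℝ := (2 / Real.sqrt Real.pi) * ∫ u in Set.Ioi x, Real.exp (-u ^ 2)

/-- `F(x) = (1/2) erfc(x/√2)`. -/
def Ferfc (x : ℝ) : ℝ := erfc (x / Real.sqrt 2) / 2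

/-- `𝓕(x) = e^{−x²/2} − √(2π) x F(x)`. -/
def calF (x : ℝ) : ℝ :=
  Real.exp (-x ^ 2 / 2) - Real.sqrt (2 * Real.pi) * x * Ferfc x

/-- A quadratic refinement of the tangent-line bound for the logarithm on `(0, 1]`. -/
lemma log_sub_log_le_of_le_one {t c : ℝ} (ht : 0 < t) (ht1 : t ≤ 1) (hc : 0 < c) (hc1 : c ≤ 1) :
    Real.log t - Real.log c ≤ (t - c) / c - (t - c) ^ 2 / 4 := by
  obtain ⟨u, hu, rfl⟩ : ∃ u : ℝ, 0 < u ∧ t = u ^ 2 := ⟨√t, by positivity, (Real.sq_sqrt ht.le).symm⟩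
  obtain ⟨v, hv, rfl⟩ : ∃ v : ℝ, 0 < v ∧ c = v ^ 2 := ⟨√c, by positivity, (Real.sq_sqrt hc.le).symm⟩
  have hu1 : u ≤ 1 := by nlinarith
  have hv1 : v ≤ 1 := by nlinarith
  have h1 : Real.log (u / v) ≤ u / v - 1 := Real.log_le_sub_one_of_pos (by positivity)
  rw [Real.log_div hu.ne' hv.ne'] at h1
  rw [Real.log_pow, Real.log_pow]
  push_cast
  have h2 : (u ^ 2 - v ^ 2) / v ^ 2 - 2 * (u / v - 1) = (u - v) ^ 2 / v ^ 2 := by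
    field_simp; ring
  have h3 : (u - v) ^ 2 ≤ (u - v) ^ 2 / v ^ 2 := by
    rw [le_div_iff₀ (by positivity)]
    nlinarith [sq_nonneg (u - v)]
  have h4 : (u ^ 2 - v ^ 2) ^ 2 / 4 ≤ (u - v) ^ 2 := by
    have : (u ^ 2 - v ^ 2) ^ 2 = (u - v) ^ 2 * (u + v) ^ 2 := by ring
    rw [this]
    nlinarith [sq_nonneg (u - v), mul_nonneg (sq_nonneg (u - v)) (by nlinarith : 0 ≤ 4 - (u + v) ^ 2)]
  linarith

/-- Second-order expansion of `N (log (1 + z) - z)` when `z` is of order `N^{-1/2}`. -/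
lemma tendsto_mul_log_one_add_sub {z : ℕ → ℝ} {c : ℝ}
    (hz : Tendsto (fun N : ℕ => √(N : ℝ) * z N) atTop (nhds c)) :
    Tendsto (fun N : ℕ => (N : ℝ) * (Real.log (1 + z N) - z N)) atTop (nhds (-c ^ 2 / 2)) := by
  have hs : Tendsto (fun N : ℕ => √(N : ℝ)) atTop atTop :=
    Real.tendsto_sqrt_atTop.comp tendsto_natCast_atTop_atTop
  have hz0 : Tendsto z atTop (nhds 0) := by
    have := hs.inv_tendsto_atTop.mul hz
    rw [zero_mul] at this
    refine this.congr' ?_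
    filter_upwards [eventually_gt_atTop 0] with N hN
    have : 0 < √(N : ℝ) := by positivity
    simp only [Pi.inv_apply]
    field_simp
  have hN2 : Tendsto (fun N : ℕ => (N : ℝ) * z N ^ 2) atTop (nhds (c ^ 2)) := by
    refine (hz.pow 2).congr fun N => ?_
    rw [mul_pow, Real.sq_sqrt (by positivity)]
  have habs : Tendsto (fun N => |z N|) atTop (nhds 0) := by simpa using hz0.abs
  have herr : Tendsto (fun N : ℕ => (N : ℝ) * z N ^ 2 * (|z N| / (1 - |z N|))) atTop (nhds 0) := by
    have := hN2.mul (habs.div (tendsto_const_nhds.sub habs) (by norm_num : (1 : ℝ) - 0 ≠ 0))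
    simpa using this
  have hmain : Tendsto (fun N : ℕ => (N : ℝ) * (Real.log (1 + z N) - z N) + N * z N ^ 2 / 2)
      atTop (nhds 0) := by
    refine squeeze_zero_norm' ?_ herr
    filter_upwards [habs.eventually_lt_const (by norm_num : (0 : ℝ) < 1)] with N hN
    have h := Real.abs_log_sub_add_sum_range_le (x := -z N) (by simpa using hN) 2
    simp only [Finset.sum_range_succ, Finset.sum_range_zero, abs_neg, sub_neg_eq_add] at h
    rw [Real.norm_eq_abs]
    have e : (N : ℝ) * (Real.log (1 + z N) - z N) + N * z N ^ 2 / 2 =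
        N * (0 + (-z N) ^ (0 + 1) / (((0 : ℕ) : ℝ) + 1) + (-z N) ^ (1 + 1) / (((1 : ℕ) : ℝ) + 1)
          + Real.log (1 + z N)) := by
      push_cast; ring
    rw [e, abs_mul, abs_of_nonneg (by positivity : (0 : ℝ) ≤ N)]
    calc _ ≤ (N : ℝ) * (|z N| ^ (2 + 1) / (1 - |z N|)) := by gcongr
      _ = _ := by rw [← sq_abs (z N)]; ring
  have := hmain.sub (hN2.div_const 2)
  convert this using 2
  · ring
  · ring

/-- The saddle point of `t ↦ t ^ A * (1 - t) ^ b`. -/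
def edgePt (A b : ℝ) : ℝ := A / (A + b)

/-- The width of the saddle of `t ↦ t ^ A * (1 - t) ^ b`, normalised so that the
limiting profile is `exp (-s ^ 2)`. -/
def edgeScale (A b : ℝ) : ℝ := √(2 * A * b / (A + b) ^ 3)

/-- The (unnormalised) density of the beta distribution with parameters `A N + 1` and `b N`. -/
def betaKernel (A b : ℝ) (N : ℕ) (t : ℝ) : ℝ := t ^ (A * N) * (1 - t) ^ (b * N - 1)

/-- The beta density rescaled around its saddle point. -/
def rescaledKernel (A b : ℝ) (N : ℕ) (s : ℝ) : ℝ :=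
  (Set.Ioo (0 : ℝ) 1).indicator (fun t => betaKernel A b N t / betaKernel A b N (edgePt A b))
    (edgePt A b + edgeScale A b / √N * s)

lemma edgePt_mem {A b : ℝ} (hA : 0 < A) (hb : 0 < b) : edgePt A b ∈ Set.Ioo (0 : ℝ) 1 := by
  unfold edgePt
  constructor
  · positivity
  · rw [div_lt_one (by positivity)]; linarith

lemma one_sub_edgePt {A b : ℝ} (hA : 0 < A) (hb : 0 < b) : 1 - edgePt A b = b / (A + b) := by
  unfold edgePt
  field_simp; ring

lemma edgeScale_pos {A b : ℝ} (hA : 0 < A) (hb : 0 < b) : 0 < edgeScale A b := by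
  unfold edgeScale; positivity

lemma betaKernel_pos (A b : ℝ) (N : ℕ) {t : ℝ} (ht : t ∈ Set.Ioo (0 : ℝ) 1) :
    0 < betaKernel A b N t :=
  mul_pos (Real.rpow_pos_of_pos ht.1 _) (Real.rpow_pos_of_pos (by linarith [ht.2]) _)

lemma betaKernel_div {A b : ℝ} (hA : 0 < A) (hb : 0 < b) (N : ℕ) {t : ℝ}
    (ht : t ∈ Set.Ioo (0 : ℝ) 1) :
    betaKernel A b N t / betaKernel A b N (edgePt A b) =
      Real.exp (A * N * (Real.log t - Real.log (edgePt A b)) +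
        (b * N - 1) * (Real.log (1 - t) - Real.log (1 - edgePt A b))) := by
  obtain ⟨h0, h1⟩ := edgePt_mem hA hb
  have h1' : 0 < 1 - edgePt A b := by linarith
  have ht1 : 0 < 1 - t := by linarith [ht.2]
  unfold betaKernel
  rw [Real.rpow_def_of_pos ht.1, Real.rpow_def_of_pos ht1, Real.rpow_def_of_pos h0,
    Real.rpow_def_of_pos h1', ← Real.exp_add, ← Real.exp_add, ← Real.exp_sub]
  congr 1
  ring

lemma rescaledKernel_nonneg {A b : ℝ} (hA : 0 < A) (hb : 0 < b) (N : ℕ) (s : ℝ) :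
    0 ≤ rescaledKernel A b N s := by
  refine Set.indicator_nonneg (fun t ht => ?_) _
  exact (div_pos (betaKernel_pos A b N ht) (betaKernel_pos A b N (edgePt_mem hA hb))).le

/-- A Gaussian bound for the rescaled beta density, uniform in `N`. -/
lemma rescaledKernel_le {A b : ℝ} (hA : 0 < A) (hb : 0 < b) {N : ℕ} (hN : 0 < N)
    (hbN : 1 ≤ b * N) (s : ℝ) :
    rescaledKernel A b N s ≤
      Real.exp (2 / (A * (1 - edgePt A b) ^ 2)) *
        Real.exp (-(A * edgeScale A b ^ 2 / 8) * s ^ 2) := by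
  obtain ⟨h0, h1⟩ := edgePt_mem hA hb
  have h1' : 0 < 1 - edgePt A b := by linarith
  refine Set.indicator_le' (s := Set.Ioo (0 : ℝ) 1)
    (f := fun t => betaKernel A b N t / betaKernel A b N (edgePt A b))
    (g := fun t => Real.exp (2 / (A * (1 - edgePt A b) ^ 2)) *
        Real.exp (-(A * N / 8) * (t - edgePt A b) ^ 2)) ?_ ?_ _ |>.trans ?_
  · intro t ht
    have hN1 : (1 : ℝ) ≤ N := by exact_mod_cast hN
    rw [betaKernel_div hA hb N ht, ← Real.exp_add]
    apply Real.exp_le_exp.mpr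
    have e1 := log_sub_log_le_of_le_one ht.1 ht.2.le h0 h1.le
    have e2 := log_sub_log_le_of_le_one (by linarith [ht.2] : 0 < 1 - t) (by linarith [ht.1])
      h1' (by linarith)
    have e1' := mul_le_mul_of_nonneg_left e1 (by positivity : 0 ≤ A * N)
    have e2' := mul_le_mul_of_nonneg_left e2 (by linarith : 0 ≤ b * N - 1)
    have hlin : A * N * ((t - edgePt A b) / edgePt A b)
        + (b * N - 1) * ((1 - t - (1 - edgePt A b)) / (1 - edgePt A b))
        = (t - edgePt A b) / (1 - edgePt A b) := by
      rw [one_sub_edgePt hA hb]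
      unfold edgePt
      field_simp
      ring
    set d := t - edgePt A b with hd
    have hd2 : (1 - t - (1 - edgePt A b)) ^ 2 = d ^ 2 := by rw [hd]; ring
    have hy : d / (1 - edgePt A b) ≤ 2 / (A * (1 - edgePt A b) ^ 2) + A / 8 * d ^ 2 := by
      have : 2 / (A * (1 - edgePt A b) ^ 2) + A / 8 * d ^ 2 - d / (1 - edgePt A b)
          = A / 8 * (d - 4 / (A * (1 - edgePt A b))) ^ 2 := by
        field_simp; ring
      have : 0 ≤ A / 8 * (d - 4 / (A * (1 - edgePt A b))) ^ 2 := by positivity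
      linarith
    have hAN : A / 8 * d ^ 2 ≤ A * N / 8 * d ^ 2 := by
      have : A * d ^ 2 * 1 ≤ A * d ^ 2 * N := by gcongr
      linarith
    have hb' : 0 ≤ (b * N - 1) * (d ^ 2 / 4) := mul_nonneg (by linarith) (by positivity)
    rw [hd2] at e2'
    nlinarith
  · intro t _; positivity
  · have hs : √(N : ℝ) ^ 2 = N := Real.sq_sqrt (by positivity)
    have hs0 : 0 < √(N : ℝ) := by positivity
    refine le_of_eq ?_
    dsimp only
    congr 2
    rw [add_sub_cancel_left, mul_pow, div_pow, hs]
    field_simp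

/-- The rescaled beta density converges to a Gaussian along convergent sequences. -/
lemma tendsto_rescaledKernel {A b : ℝ} (hA : 0 < A) (hb : 0 < b) {s : ℕ → ℝ} {s₀ : ℝ}
    (hs : Tendsto s atTop (nhds s₀)) :
    Tendsto (fun N => rescaledKernel A b N (s N)) atTop (nhds (Real.exp (-s₀ ^ 2))) := by
  obtain ⟨h0, h1⟩ := edgePt_mem hA hb
  have h1' : 0 < 1 - edgePt A b := by linarith
  have hsq : Tendsto (fun N : ℕ => √(N : ℝ)) atTop atTop :=
    Real.tendsto_sqrt_atTop.comp tendsto_natCast_atTop_atTop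
  set d : ℕ → ℝ := fun N => edgeScale A b / √N * s N with hd
  have hsd : Tendsto (fun N : ℕ => √(N : ℝ) * d N) atTop (nhds (edgeScale A b * s₀)) := by
    refine (hs.const_mul (edgeScale A b)).congr' ?_
    filter_upwards [eventually_gt_atTop 0] with N hN
    have : 0 < √(N : ℝ) := by positivity
    simp only [hd]; field_simp
  have hd0 : Tendsto d atTop (nhds 0) := by
    simpa using (hsq.const_div_atTop (edgeScale A b)).mul hs
  have hz1 : Tendsto (fun N : ℕ => √(N : ℝ) * (d N / edgePt A b)) atTop
      (nhds (edgeScale A b * s₀ / edgePt A b)) :=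
    (hsd.div_const _).congr fun N => by ring
  have hz2 : Tendsto (fun N : ℕ => √(N : ℝ) * (-d N / (1 - edgePt A b))) atTop
      (nhds (-(edgeScale A b * s₀) / (1 - edgePt A b))) :=
    (hsd.neg.div_const _).congr fun N => by ring
  have L1 := (tendsto_mul_log_one_add_sub hz1).const_mul A
  have L2 := (tendsto_mul_log_one_add_sub hz2).const_mul b
  have L3 : Tendsto (fun N => Real.log (1 + -d N / (1 - edgePt A b))) atTop (nhds 0) := by
    have h : Tendsto (fun N => 1 + -d N / (1 - edgePt A b)) atTop (nhds 1) := by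
      simpa using (hd0.neg.div_const (1 - edgePt A b)).const_add 1
    simpa using h.log one_ne_zero
  have key := (Real.continuous_exp.tendsto _).comp ((L1.add L2).sub L3)
  have hlim : A * (-(edgeScale A b * s₀ / edgePt A b) ^ 2 / 2) +
      b * (-(-(edgeScale A b * s₀) / (1 - edgePt A b)) ^ 2 / 2) - 0 = -s₀ ^ 2 := by
    have hsc : edgeScale A b ^ 2 = 2 * A * b / (A + b) ^ 3 := Real.sq_sqrt (by positivity)
    rw [one_sub_edgePt hA hb, div_pow, div_pow, neg_sq, mul_pow, hsc]
    unfold edgePt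
    field_simp
    ring
  rw [hlim] at key
  refine key.congr' ?_
  have hmem : ∀ᶠ N in atTop, edgePt A b + d N ∈ Set.Ioo (0 : ℝ) 1 := by
    have : Tendsto (fun N => edgePt A b + d N) atTop (nhds (edgePt A b)) := by
      simpa using hd0.const_add (edgePt A b)
    exact this.eventually (Ioo_mem_nhds h0 h1)
  filter_upwards [hmem] with N hN
  unfold rescaledKernel
  rw [Set.indicator_of_mem hN, betaKernel_div hA hb N hN, Function.comp]
  congr 1
  have g1 : Real.log (edgePt A b + d N) - Real.log (edgePt A b)
      = Real.log (1 + d N / edgePt A b) := by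
    rw [← Real.log_div hN.1.ne' h0.ne']
    congr 1; field_simp
  have g2 : Real.log (1 - (edgePt A b + d N)) - Real.log (1 - edgePt A b)
      = Real.log (1 + -d N / (1 - edgePt A b)) := by
    rw [← Real.log_div (by linarith [hN.2]) h1'.ne']
    congr 1; field_simp; ring
  have hcancel : A * (d N / edgePt A b) + b * (-d N / (1 - edgePt A b)) = 0 := by
    rw [one_sub_edgePt hA hb]
    unfold edgePt
    field_simp
    ring
  change _ = A * N * (Real.log (edgePt A b + d N) - Real.log (edgePt A b)) +
    (b * N - 1) * (Real.log (1 - (edgePt A b + d N)) - Real.log (1 - edgePt A b))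
  rw [g1, g2]
  linear_combination -(N : ℝ) * hcancel

lemma measurable_betaKernel (A b : ℝ) (N : ℕ) : Measurable (betaKernel A b N) := by
  unfold betaKernel; fun_prop

lemma measurable_rescaledKernel (A b : ℝ) (N : ℕ) : Measurable (rescaledKernel A b N) := by
  have h : Measurable
      ((Set.Ioo (0 : ℝ) 1).indicator fun t => betaKernel A b N t / betaKernel A b N (edgePt A b)) :=
    ((measurable_betaKernel A b N).div_const _).indicator measurableSet_Ioo
  exact h.comp (by fun_prop : Measurable fun s => edgePt A b + edgeScale A b / √(N : ℝ) * s)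

lemma eventually_one_le_mul_natCast {b : ℝ} (hb : 0 < b) : ∀ᶠ N : ℕ in atTop, 1 ≤ b * N :=
  (tendsto_natCast_atTop_atTop.const_mul_atTop hb).eventually_ge_atTop 1

lemma tendsto_integral_of_le_rescaledKernel {A b : ℝ} (hA : 0 < A) (hb : 0 < b)
    {F : ℕ → ℝ → ℝ} {f : ℝ → ℝ} (hm : ∀ N, Measurable (F N))
    (hF : ∀ N s, ‖F N s‖ ≤ rescaledKernel A b N s)
    (hlim : ∀ᵐ s, Tendsto (fun N => F N s) atTop (nhds (f s))) :
    Tendsto (fun N => ∫ s, F N s) atTop (nhds (∫ s, f s)) := by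
  have hτ := edgeScale_pos hA hb
  refine tendsto_integral_filter_of_dominated_convergence
    (fun s => Real.exp (2 / (A * (1 - edgePt A b) ^ 2)) *
      Real.exp (-(A * edgeScale A b ^ 2 / 8) * s ^ 2))
    (Eventually.of_forall fun N => (hm N).aestronglyMeasurable) ?_
    ((integrable_exp_neg_mul_sq (by positivity)).const_mul _) hlim
  filter_upwards [eventually_gt_atTop 0, eventually_one_le_mul_natCast hb] with N hN hbN
  exact Eventually.of_forall fun s => (hF N s).trans (rescaledKernel_le hA hb hN hbN s)

lemma tendsto_integral_rescaledKernel {A b : ℝ} (hA : 0 < A) (hb : 0 < b) :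
    Tendsto (fun N => ∫ s, rescaledKernel A b N s) atTop (nhds √Real.pi) := by
  have h := tendsto_integral_of_le_rescaledKernel hA hb (F := fun N => rescaledKernel A b N)
    (f := fun s => Real.exp (-s ^ 2)) (measurable_rescaledKernel A b)
    (fun N s => by rw [Real.norm_of_nonneg (rescaledKernel_nonneg hA hb N s)])
    (Eventually.of_forall fun s => tendsto_rescaledKernel hA hb tendsto_const_nhds)
  have e := integral_gaussian 1
  simp only [neg_mul, one_mul, div_one] at e
  rwa [e] at h

lemma tendsto_integral_Ioi_rescaledKernel {A b : ℝ} (hA : 0 < A) (hb : 0 < b) {s : ℕ → ℝ} {s₀ : ℝ}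
    (hs : Tendsto s atTop (nhds s₀)) :
    Tendsto (fun N => ∫ x, (Set.Ioi (s N)).indicator (rescaledKernel A b N) x) atTop
      (nhds (∫ x in Set.Ioi s₀, Real.exp (-x ^ 2))) := by
  rw [← integral_indicator measurableSet_Ioi]
  refine tendsto_integral_of_le_rescaledKernel hA hb
    (fun N => (measurable_rescaledKernel A b N).indicator measurableSet_Ioi) (fun N x => ?_) ?_
  · rw [Real.norm_of_nonneg (Set.indicator_nonneg (fun _ _ => rescaledKernel_nonneg hA hb N _) _)]
    exact Set.indicator_le_self' (fun _ _ => rescaledKernel_nonneg hA hb N _) _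
  · have hne : ∀ᵐ x : ℝ, x ≠ s₀ := by simp [ae_iff]
    filter_upwards [hne] with x hx
    rcases lt_or_gt_of_ne hx with h | h
    · rw [Set.indicator_of_notMem (by simpa using h.le)]
      refine tendsto_const_nhds.congr' ?_
      filter_upwards [hs.eventually_const_lt h] with N hN
      rw [Set.indicator_of_notMem (by simpa using hN.le)]
    · rw [Set.indicator_of_mem (by simpa using h)]
      refine (tendsto_rescaledKernel hA hb tendsto_const_nhds).congr' ?_
      filter_upwards [hs.eventually_lt_const h] with N hN
      rw [Set.indicator_of_mem (by simpa using hN)]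

lemma integral_eq_mul_integral_comp_add_mul (F : ℝ → ℝ) (t : ℝ) {c : ℝ} (hc : 0 < c) :
    ∫ x, F x = c * ∫ s, F (t + c * s) := by
  rw [Measure.integral_comp_mul_left (fun y => F (t + y)) c, integral_add_left_eq_self F t,
    abs_of_pos (by positivity), smul_eq_mul, mul_inv_cancel_left₀ hc.ne']

lemma integral_betaKernel {A b : ℝ} (hA : 0 < A) (hb : 0 < b) {N : ℕ} (hN : 0 < N) :
    ∫ t in Set.Ioo 0 1, betaKernel A b N t =
      betaKernel A b N (edgePt A b) * (edgeScale A b / √N) * ∫ s, rescaledKernel A b N s := by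
  have hτ := edgeScale_pos hA hb
  have hk := betaKernel_pos A b N (edgePt_mem hA hb)
  rw [← integral_indicator measurableSet_Ioo,
    integral_eq_mul_integral_comp_add_mul _ (edgePt A b) (c := edgeScale A b / √N) (by positivity),
    mul_comm (betaKernel A b N _), mul_assoc]
  congr 1
  rw [← integral_const_mul]
  refine integral_congr_ae (Eventually.of_forall fun s => ?_)
  dsimp only
  unfold rescaledKernel
  simp only [Set.indicator]
  split_ifs
  · field_simp
  · simp

lemma integral_Ioo_betaKernel {A b : ℝ} (hA : 0 < A) (hb : 0 < b) {N : ℕ} (hN : 0 < N) {T : ℝ}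
    (hT : 0 ≤ T) :
    ∫ t in Set.Ioo T 1, betaKernel A b N t =
      betaKernel A b N (edgePt A b) * (edgeScale A b / √N) *
        ∫ s, (Set.Ioi (√N * (T - edgePt A b) / edgeScale A b)).indicator
          (rescaledKernel A b N) s := by
  have hτ := edgeScale_pos hA hb
  have hs0 : 0 < √(N : ℝ) := by positivity
  have hk := betaKernel_pos A b N (edgePt_mem hA hb)
  rw [← integral_indicator measurableSet_Ioo,
    integral_eq_mul_integral_comp_add_mul _ (edgePt A b) (c := edgeScale A b / √N) (by positivity),
    mul_comm (betaKernel A b N _), mul_assoc]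
  congr 1
  rw [← integral_const_mul]
  refine integral_congr_ae (Eventually.of_forall fun s => ?_)
  dsimp only
  have hiff : s ∈ Set.Ioi (√N * (T - edgePt A b) / edgeScale A b) ↔
      T < edgePt A b + edgeScale A b / √N * s := by
    rw [Set.mem_Ioi, div_lt_iff₀ hτ, ← sub_lt_iff_lt_add', div_mul_eq_mul_div, lt_div_iff₀ hs0]
    constructor <;> intro h <;> linarith
  unfold rescaledKernel
  simp only [Set.indicator, hiff, Set.mem_Ioo]
  by_cases h1 : T < edgePt A b + edgeScale A b / √N * s
  · have h0 : 0 < edgePt A b + edgeScale A b / √N * s := hT.trans_lt h1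
    simp only [h1, h0, true_and, if_true]
    split_ifs
    · field_simp
    · simp
  · simp [h1]

lemma integral_betaKernel_eq_Gamma {A b : ℝ} (hA : 0 < A) (hb : 0 < b) {N : ℕ} (hN : 0 < N) :
    ∫ t in Set.Ioo 0 1, betaKernel A b N t =
      Real.Gamma (A * N + 1) * Real.Gamma (b * N) / Real.Gamma (A * N + 1 + b * N) := by
  have h := ProbabilityTheory.beta_eq_betaIntegralReal (A * N + 1) (b * N)
    (by positivity) (by positivity)
  unfold ProbabilityTheory.beta at h
  rw [h, Complex.betaIntegral, ← integral_Ioc_eq_integral_Ioo,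
    ← intervalIntegral.integral_of_le zero_le_one]
  have : ∫ x in (0 : ℝ)..1, (x : ℂ) ^ (((A * N + 1 : ℝ) : ℂ) - 1) *
      (1 - (x : ℂ)) ^ (((b * N : ℝ) : ℂ) - 1) =
      ((∫ x in (0 : ℝ)..1, betaKernel A b N x : ℝ) : ℂ) := by
    rw [← intervalIntegral.integral_ofReal]
    refine intervalIntegral.integral_congr fun x hx => ?_
    rw [Set.uIcc_of_le zero_le_one] at hx
    unfold betaKernel
    push_cast
    rw [Complex.ofReal_cpow hx.1, Complex.ofReal_cpow (by linarith [hx.2])]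
    push_cast
    rw [add_sub_cancel_right]
  rw [this, Complex.ofReal_re]

/-- The generalised binomial coefficients appearing in `qS`. -/
def betaCoeff (n L : ℝ) (k : ℕ) : ℝ :=
  Real.Gamma (L + n + 1) / (Real.Gamma ((k : ℝ) + L + 1) * Real.Gamma (n + 1 - k))

/-- The generalised binomial weights `C_k t^{L+k} (1-t)^{n-k}`. -/
def betaTerm (n L : ℝ) (k : ℕ) (t : ℝ) : ℝ :=
  betaCoeff n L k * (t ^ (L + k) * (1 - t) ^ (n - k))

lemma betaCoeff_nonneg {n L : ℝ} (hL : 0 ≤ L) {k : ℕ} (hk : k < n) : 0 ≤ betaCoeff n L k := by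
  have hk0 : (0 : ℝ) ≤ k := by positivity
  have h1 := Real.Gamma_pos_of_pos (by linarith : 0 < L + n + 1)
  have h2 := Real.Gamma_pos_of_pos (by linarith : 0 < (k : ℝ) + L + 1)
  have h3 := Real.Gamma_pos_of_pos (by linarith : 0 < n + 1 - (k : ℝ))
  unfold betaCoeff; positivity

lemma betaTerm_nonneg {n L : ℝ} (hL : 0 ≤ L) {k : ℕ} (hk : k < n) {t : ℝ}
    (ht : t ∈ Set.Ioo (0 : ℝ) 1) : 0 ≤ betaTerm n L k t :=
  mul_nonneg (betaCoeff_nonneg hL hk) (mul_nonneg (Real.rpow_nonneg ht.1.le _)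
    (Real.rpow_nonneg (by linarith [ht.2]) _))

lemma betaCoeff_succ {n L : ℝ} (hL : 0 ≤ L) {k : ℕ} (hk : k < n) :
    (L + k + 1) * betaCoeff n L (k + 1) = (n - k) * betaCoeff n L k := by
  have hk0 : (0 : ℝ) ≤ k := by positivity
  have h2 := Real.Gamma_pos_of_pos (by linarith : 0 < (k : ℝ) + L + 1)
  have h3 := Real.Gamma_pos_of_pos (by linarith : 0 < n - (k : ℝ))
  have g1 : Real.Gamma (((k + 1 : ℕ) : ℝ) + L + 1) = (k + L + 1) * Real.Gamma (k + L + 1) := by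
    rw [← Real.Gamma_add_one (by linarith)]; congr 1; push_cast; ring
  have g2 : Real.Gamma (n + 1 - k) = (n - k) * Real.Gamma (n - k) := by
    rw [← Real.Gamma_add_one (by linarith)]; congr 1; ring
  have g3 : n + 1 - ((k + 1 : ℕ) : ℝ) = n - k := by push_cast; ring
  unfold betaCoeff
  rw [g1, g2, g3]
  have : n - (k : ℝ) ≠ 0 := by linarith
  have : (k : ℝ) + L + 1 ≠ 0 := by linarith
  field_simp
  ring

/-- The first-order recursion for the generalised binomial weights. -/
lemma betaTerm_succ {n L : ℝ} (hL : 0 ≤ L) {k : ℕ} (hk : k < n) {t : ℝ}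
    (ht : t ∈ Set.Ioo (0 : ℝ) 1) :
    (L + k + 1) * (1 - t) * betaTerm n L (k + 1) t = (n - k) * t * betaTerm n L k t := by
  have ht1 : 0 < 1 - t := by linarith [ht.2]
  have e1 : t ^ (L + ((k + 1 : ℕ) : ℝ)) = t ^ (L + k) * t := by
    rw [← Real.rpow_add_one ht.1.ne']; congr 1; push_cast; ring
  have e2 : (1 - t) ^ (n - (k : ℝ)) = (1 - t) ^ (n - ((k + 1 : ℕ) : ℝ)) * (1 - t) := by
    rw [← Real.rpow_add_one ht1.ne']; congr 1; push_cast; ring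
  unfold betaTerm
  rw [e1, e2]
  linear_combination (1 - t) * (t ^ (L + k) * t * (1 - t) ^ (n - ((k + 1 : ℕ) : ℝ))) *
    betaCoeff_succ hL hk

lemma hasDerivAt_betaTerm (n L : ℝ) (k : ℕ) {t : ℝ} (ht : t ∈ Set.Ioo (0 : ℝ) 1) :
    HasDerivAt (betaTerm n L k)
      (betaCoeff n L k * ((L + k) * (t ^ (L + k - 1) * (1 - t) ^ (n - k))
        - (n - k) * (t ^ (L + k) * (1 - t) ^ (n - k - 1)))) t := by
  have ht1 : 0 < 1 - t := by linarith [ht.2]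
  have h1 := (hasDerivAt_id t).rpow_const (p := L + k) (Or.inl ht.1.ne')
  have h2 := ((hasDerivAt_id t).const_sub 1).rpow_const (p := n - k) (Or.inl ht1.ne')
  have := (h1.mul h2).const_mul (betaCoeff n L k)
  refine this.congr_deriv ?_
  simp only [id]
  ring

lemma hasDerivAt_sum_betaTerm {n L : ℝ} (hL : 0 ≤ L) {N : ℕ} (hN : N < n) {t : ℝ}
    (ht : t ∈ Set.Ioo (0 : ℝ) 1) :
    HasDerivAt (fun t => ∑ k ∈ Finset.range (N + 1), betaTerm n L k t)
      (L * betaCoeff n L 0 * (t ^ (L - 1) * (1 - t) ^ n)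
        - (n - N) * betaCoeff n L N * (t ^ (L + N) * (1 - t) ^ (n - N - 1))) t := by
  have h := HasDerivAt.fun_sum (u := Finset.range (N + 1))
    fun k _ => hasDerivAt_betaTerm n L k ht
  refine h.congr_deriv ?_
  clear h
  induction N with
  | zero => simp; ring
  | succ m ih =>
    have hm : (m : ℝ) < n := by push_cast at hN; linarith
    rw [Finset.sum_range_succ, ih hm]
    have hc := betaCoeff_succ hL hm
    have e1 : L + ((m + 1 : ℕ) : ℝ) - 1 = L + m := by push_cast; ring
    have e2 : n - ((m + 1 : ℕ) : ℝ) = n - m - 1 := by push_cast; ring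
    rw [e1, e2]
    push_cast
    linear_combination (t ^ (L + m) * (1 - t) ^ (n - m - 1)) * hc

/-- A partial sum of generalised binomial weights as a difference of two beta tails. -/
lemma sum_betaTerm_eq_integral {n L : ℝ} (hL : 0 ≤ L) {N : ℕ} (hN : N + 1 ≤ n) {T : ℝ}
    (hT : T ∈ Set.Ioo (0 : ℝ) 1) :
    ∑ k ∈ Finset.range (N + 1), betaTerm n L k T =
      (n - N) * betaCoeff n L N * (∫ t in T..1, t ^ (L + N) * (1 - t) ^ (n - N - 1))
        - L * betaCoeff n L 0 * ∫ t in T..1, t ^ (L - 1) * (1 - t) ^ n := by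
  have hN0 : (0 : ℝ) ≤ N := by positivity
  have hint : ∀ p q : ℝ, 0 ≤ q →
      ContinuousOn (fun t : ℝ => t ^ p * (1 - t) ^ q) (Set.Icc T 1) := by
    intro p q hq
    refine ContinuousOn.mul ?_ ?_
    · exact continuousOn_id.rpow_const fun x hx => Or.inl (hT.1.trans_le hx.1).ne'
    · exact (continuousOn_const.sub continuousOn_id).rpow_const fun x hx => Or.inr hq
  have hint' : ∀ p q : ℝ, 0 ≤ q →
      IntervalIntegrable (fun t : ℝ => t ^ p * (1 - t) ^ q) volume T 1 := fun p q hq =>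
    ContinuousOn.intervalIntegrable (by rw [Set.uIcc_of_le hT.2.le]; exact hint p q hq)
  have i1 := (hint' (L - 1) n (by linarith)).const_mul (L * betaCoeff n L 0)
  have i2 := (hint' (L + N) (n - N - 1) (by linarith)).const_mul ((n - N) * betaCoeff n L N)
  have hcont : ContinuousOn (fun t => ∑ k ∈ Finset.range (N + 1), betaTerm n L k t)
      (Set.Icc T 1) := by
    refine continuousOn_finsetSum _ fun k hk => ContinuousOn.mul continuousOn_const ?_
    have : (k : ℝ) ≤ N := by exact_mod_cast Nat.lt_succ_iff.mp (Finset.mem_range.mp hk)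
    exact hint _ _ (by linarith)
  have h := intervalIntegral.integral_eq_sub_of_hasDerivAt_of_le hT.2.le hcont
    (fun t ht => hasDerivAt_sum_betaTerm hL (by linarith) ⟨hT.1.trans ht.1, ht.2⟩) (i1.sub i2)
  rw [intervalIntegral.integral_sub i1 i2, intervalIntegral.integral_const_mul,
    intervalIntegral.integral_const_mul] at h
  have h1 : ∑ k ∈ Finset.range (N + 1), betaTerm n L k 1 = 0 := by
    refine Finset.sum_eq_zero fun k hk => ?_
    have : (k : ℝ) ≤ N := by exact_mod_cast Nat.lt_succ_iff.mp (Finset.mem_range.mp hk)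
    unfold betaTerm
    rw [sub_self, Real.zero_rpow (by linarith), mul_zero, mul_zero]
  rw [h1] at h
  linarith

lemma rpow_mul_one_sub_rpow_le {n L : ℝ} (hL : 0 ≤ L) (hn : 0 < n) {T t : ℝ}
    (hT : T ∈ Set.Ioo (0 : ℝ) 1) (hmode : L * (1 - T) ≤ n * T) (hTt : T ≤ t) (ht : t ≤ 1) :
    t ^ L * (1 - t) ^ n ≤ T ^ L * (1 - T) ^ n := by
  have hT1 : 0 < 1 - T := by linarith [hT.2]
  have ht0 : 0 < t := hT.1.trans_le hTt
  rcases ht.eq_or_lt with rfl | ht1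
  · rw [sub_self, Real.zero_rpow hn.ne', mul_zero]
    exact mul_nonneg (Real.rpow_nonneg hT.1.le _) (Real.rpow_nonneg hT1.le _)
  have ht1' : 0 < 1 - t := by linarith
  rw [Real.rpow_def_of_pos ht0, Real.rpow_def_of_pos ht1', Real.rpow_def_of_pos hT.1,
    Real.rpow_def_of_pos hT1, ← Real.exp_add, ← Real.exp_add, Real.exp_le_exp]
  have h1 := Real.log_le_sub_one_of_pos (div_pos ht0 hT.1)
  have h2 := Real.log_le_sub_one_of_pos (div_pos ht1' hT1)
  rw [Real.log_div ht0.ne' hT.1.ne'] at h1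
  rw [Real.log_div ht1'.ne' hT1.ne'] at h2
  have h1' := mul_le_mul_of_nonneg_left h1 hL
  have h2' := mul_le_mul_of_nonneg_left h2 hn.le
  have h3 : L * (t / T - 1) + n * ((1 - t) / (1 - T) - 1)
      = (t - T) * (L * (1 - T) - n * T) / (T * (1 - T)) := by
    field_simp [hT.1.ne']
    ring
  have h4 : (t - T) * (L * (1 - T) - n * T) / (T * (1 - T)) ≤ 0 :=
    div_nonpos_of_nonpos_of_nonneg
      (mul_nonpos_of_nonneg_of_nonpos (by linarith) (by linarith)) (mul_pos hT.1 hT1).le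
  nlinarith

/-- The beta tail beyond a point `T` above the mode is controlled by the density at `T`. -/
lemma betaCoeff_zero_mul_integral_le {n L : ℝ} (hL : 0 ≤ L) (hn : 0 < n) {T : ℝ}
    (hT : T ∈ Set.Ioo (0 : ℝ) 1) (hmode : L * (1 - T) ≤ n * T) :
    |L * betaCoeff n L 0 * ∫ t in T..1, t ^ (L - 1) * (1 - t) ^ n| ≤
      L * betaTerm n L 0 T / T := by
  have hT1 : 0 < 1 - T := by linarith [hT.2]
  have hc : 0 ≤ betaCoeff n L 0 := betaCoeff_nonneg hL (by simpa using hn)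
  have hb : |∫ t in T..1, t ^ (L - 1) * (1 - t) ^ n| ≤ T ^ L * (1 - T) ^ n / T * |1 - T| := by
    rw [← Real.norm_eq_abs]
    refine intervalIntegral.norm_integral_le_of_norm_le_const fun t ht => ?_
    rw [Set.uIoc_of_le hT.2.le] at ht
    have ht0 : 0 < t := hT.1.trans ht.1
    have h1t : 0 ≤ 1 - t := by linarith [ht.2]
    rw [Real.norm_of_nonneg (by positivity), Real.rpow_sub_one ht0.ne', div_mul_eq_mul_div]
    have := rpow_mul_one_sub_rpow_le hL hn hT hmode ht.1.le ht.2
    have hT0 := hT.1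
    gcongr
    exact ht.1.le
  have h2 : T ^ L * (1 - T) ^ n / T * |1 - T| ≤ T ^ L * (1 - T) ^ n / T := by
    rw [abs_of_pos hT1]
    have hT0 := hT.1
    exact mul_le_of_le_one_right (by positivity) (by linarith)
  rw [abs_mul, abs_of_nonneg (mul_nonneg hL hc)]
  calc _ ≤ L * betaCoeff n L 0 * (T ^ L * (1 - T) ^ n / T) := by
        gcongr
        exact hb.trans h2
    _ = _ := by unfold betaTerm; simp; ring

lemma integrable_rescaledKernel {A b : ℝ} (hA : 0 < A) (hb : 0 < b) {N : ℕ} (hN : 0 < N)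
    (hbN : 1 ≤ b * N) : Integrable (rescaledKernel A b N) := by
  have hτ := edgeScale_pos hA hb
  refine Integrable.mono' ((integrable_exp_neg_mul_sq
    (by positivity : 0 < A * edgeScale A b ^ 2 / 8)).const_mul
      (Real.exp (2 / (A * (1 - edgePt A b) ^ 2))))
    (measurable_rescaledKernel A b N).aestronglyMeasurable (Eventually.of_forall fun s => ?_)
  rw [Real.norm_of_nonneg (rescaledKernel_nonneg hA hb N s)]
  exact rescaledKernel_le hA hb hN hbN s

lemma mul_betaCoeff_eq_inv {a b : ℝ} (ha : 0 ≤ a) (hb : 0 < b) {N : ℕ} (hN : 0 < N) :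
    b * N * betaCoeff ((b + 1) * N) (a * N) N =
      (∫ t in Set.Ioo 0 1, betaKernel (a + 1) b N t)⁻¹ := by
  have hN0 : (0 : ℝ) < N := by exact_mod_cast hN
  rw [integral_betaKernel_eq_Gamma (by positivity) hb hN]
  unfold betaCoeff
  have e1 : a * N + (b + 1) * N + 1 = (a + 1) * N + 1 + b * N := by ring
  have e2 : (N : ℝ) + a * N + 1 = (a + 1) * N + 1 := by ring
  have e3 : (b + 1) * N + 1 - (N : ℝ) = b * N + 1 := by ring
  rw [e1, e2, e3, Real.Gamma_add_one (by positivity : b * N ≠ 0)]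
  have := Real.Gamma_pos_of_pos (by positivity : 0 < b * N)
  have := Real.Gamma_pos_of_pos (by positivity : 0 < (a + 1) * N + 1)
  field_simp

lemma integral_rescaledKernel_pos {a b : ℝ} (ha : 0 ≤ a) (hb : 0 < b) {N : ℕ} (hN : 0 < N) :
    0 < ∫ s, rescaledKernel (a + 1) b N s := by
  have hA : 0 < a + 1 := by linarith
  have hN0 : (0 : ℝ) < N := by exact_mod_cast hN
  refine (integral_nonneg (rescaledKernel_nonneg hA hb N)).lt_of_ne' fun h0 => ?_
  have h := integral_betaKernel_eq_Gamma hA hb hN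
  rw [integral_betaKernel hA hb hN, h0, mul_zero] at h
  have := Real.Gamma_pos_of_pos (by positivity : 0 < b * N)
  have := Real.Gamma_pos_of_pos (by positivity : 0 < (a + 1) * N + 1)
  have := Real.Gamma_pos_of_pos (by positivity : 0 < (a + 1) * N + 1 + b * N)
  exact absurd h (by positivity)

lemma mul_betaCoeff_mul_integral {a b : ℝ} (ha : 0 ≤ a) (hb : 0 < b) {N : ℕ} (hN : 0 < N)
    {T : ℝ} (hT : T ∈ Set.Ioo (0 : ℝ) 1) :
    ((b + 1) * N - N) * betaCoeff ((b + 1) * N) (a * N) N *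
        (∫ t in T..1, t ^ (a * N + N) * (1 - t) ^ ((b + 1) * N - N - 1)) =
      (∫ s, (Set.Ioi (√N * (T - edgePt (a + 1) b) / edgeScale (a + 1) b)).indicator
        (rescaledKernel (a + 1) b N) s) / ∫ s, rescaledKernel (a + 1) b N s := by
  have hA : 0 < a + 1 := by linarith
  have hs0 : 0 < √(N : ℝ) := by positivity
  have hτ := edgeScale_pos hA hb
  have hk := betaKernel_pos (a + 1) b N (edgePt_mem hA hb)
  have hpos := integral_rescaledKernel_pos ha hb hN
  have e1 : (b + 1) * N - (N : ℝ) = b * N := by ring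
  have e2 : a * N + N = (a + 1) * N := by ring
  rw [e1, e2, mul_betaCoeff_eq_inv ha hb hN, intervalIntegral.integral_of_le hT.2.le,
    integral_Ioc_eq_integral_Ioo]
  change _ * ∫ t in Set.Ioo T 1, betaKernel (a + 1) b N t = _
  rw [integral_Ioo_betaKernel hA hb hN hT.1.le, integral_betaKernel hA hb hN]
  field_simp

lemma sum_betaTerm_le_one {a b : ℝ} (ha : 0 ≤ a) (hb : 0 < b) {N : ℕ} (hN : 0 < N)
    (hbN : 1 ≤ b * N) {T : ℝ} (hT : T ∈ Set.Ioo (0 : ℝ) 1) :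
    ∑ k ∈ Finset.range (N + 1), betaTerm ((b + 1) * N) (a * N) k T ≤ 1 := by
  have hA : 0 < a + 1 := by linarith
  have hN0 : (0 : ℝ) < N := by exact_mod_cast hN
  rw [sum_betaTerm_eq_integral (by positivity) (by linarith) hT,
    mul_betaCoeff_mul_integral ha hb hN hT]
  have h1 : (∫ s, (Set.Ioi (√N * (T - edgePt (a + 1) b) / edgeScale (a + 1) b)).indicator
        (rescaledKernel (a + 1) b N) s) / ∫ s, rescaledKernel (a + 1) b N s ≤ 1 := by
    refine div_le_one_of_le₀ ?_ (integral_nonneg (rescaledKernel_nonneg hA hb N))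
    refine integral_mono_of_nonneg (Eventually.of_forall fun s =>
      Set.indicator_nonneg (fun _ _ => rescaledKernel_nonneg hA hb N _) _)
      (integrable_rescaledKernel hA hb hN hbN) (Eventually.of_forall fun s =>
      Set.indicator_le_self' (fun _ _ => rescaledKernel_nonneg hA hb N _) _)
  have h2 : 0 ≤ a * N * betaCoeff ((b + 1) * N) (a * N) 0 *
      ∫ t in T..1, t ^ (a * N - 1) * (1 - t) ^ ((b + 1) * N) := by
    refine mul_nonneg (mul_nonneg (by positivity)
      (betaCoeff_nonneg (by positivity) (by push_cast; positivity))) ?_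
    refine intervalIntegral.integral_nonneg hT.2.le fun t ht => ?_
    exact mul_nonneg (Real.rpow_nonneg (hT.1.le.trans ht.1) _)
      (Real.rpow_nonneg (by linarith [ht.2]) _)
  linarith

/-- The zeroth weight is negligible at the outer edge. -/
lemma tendsto_natCast_mul_betaTerm_zero {a b : ℝ} (ha : 0 ≤ a) (hb : 0 < b) {T : ℕ → ℝ}
    (hT : Tendsto T atTop (nhds (edgePt (a + 1) b))) :
    Tendsto (fun N : ℕ => (N : ℝ) * betaTerm ((b + 1) * N) (a * N) 0 (T N)) atTop (nhds 0) := by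
  have hA : 0 < a + 1 := by linarith
  obtain ⟨h0, h1⟩ := edgePt_mem hA hb
  set r : ℝ := (a + 1) / (a + 1 / 2) with hr
  have hr1 : 1 < r := by rw [hr, one_lt_div (by positivity)]; linarith
  have hr0 : 0 < r := by linarith
  have hra : r * (a + 1 / 2) = a + 1 := by rw [hr]; field_simp
  have hgeo : Tendsto (fun N : ℕ => (2 * ((N / 2 : ℕ) : ℝ) + 1) * (r⁻¹) ^ (N / 2)) atTop
      (nhds 0) := by
    have hi0 : 0 ≤ r⁻¹ := by positivity
    have hi1 : r⁻¹ < 1 := inv_lt_one_of_one_lt₀ hr1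
    have h := ((tendsto_self_mul_const_pow_of_lt_one hi0 hi1).const_mul 2).add
      (tendsto_pow_atTop_nhds_zero_of_lt_one hi0 hi1)
    rw [mul_zero, add_zero] at h
    refine (h.comp (Nat.tendsto_div_const_atTop two_ne_zero)).congr fun N => ?_
    simp only [Function.comp]
    ring
  have hgap : ∀ᶠ N in atTop, (a + 1) * (1 - T N) < (b + 1 / 2) * T N := by
    refine Tendsto.eventually_lt ((hT.const_sub 1).const_mul (a + 1)) (hT.const_mul (b + 1 / 2)) ?_
    rw [one_sub_edgePt hA hb]
    unfold edgePt
    rw [mul_div_assoc', mul_div_assoc']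
    gcongr ?_ / _
    nlinarith
  refine squeeze_zero_norm' ?_ hgeo
  filter_upwards [hgap, hT.eventually (Ioo_mem_nhds h0 h1), eventually_gt_atTop 0,
    eventually_one_le_mul_natCast hb] with N hgapN hTN hN hbN
  have hN0 : (0 : ℝ) < N := by exact_mod_cast hN
  have hL : 0 ≤ a * N := by positivity
  have hT1 : 0 < 1 - T N := by linarith [hTN.2]
  have hlt : ∀ k : ℕ, k ≤ N → (k : ℝ) < (b + 1) * N := fun k hk => by
    have : (k : ℝ) ≤ N := by exact_mod_cast hk
    nlinarith
  have hstep : ∀ k : ℕ, k ≤ N / 2 →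
      r ^ k * betaTerm ((b + 1) * N) (a * N) 0 (T N) ≤ betaTerm ((b + 1) * N) (a * N) k (T N) := by
    intro k
    induction k with
    | zero => intro _; simp
    | succ k ih =>
      intro hk
      have hk2 : 2 * (k + 1) ≤ N := by omega
      have hk2' : 2 * ((k : ℝ) + 1) ≤ N := by exact_mod_cast hk2
      have hkl := hlt k (by omega)
      have hk0 : (0 : ℝ) ≤ k := by positivity
      have hrec := betaTerm_succ hL hkl hTN
      have hnn := betaTerm_nonneg hL hkl hTN
      have hcoef : r * ((a * N + k + 1) * (1 - T N)) ≤ ((b + 1) * N - k) * T N := by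
        calc r * ((a * N + k + 1) * (1 - T N)) ≤ r * ((a + 1 / 2) * N * (1 - T N)) := by
              gcongr; linarith
          _ = N * ((a + 1) * (1 - T N)) := by rw [← hra]; ring
          _ ≤ N * ((b + 1 / 2) * T N) := by gcongr
          _ = ((b + 1 / 2) * N) * T N := by ring
          _ ≤ _ := by
            have := hTN.1
            gcongr
            linarith
      have hr_le : r * betaTerm ((b + 1) * N) (a * N) k (T N) ≤
          betaTerm ((b + 1) * N) (a * N) (k + 1) (T N) := by
        have hc : 0 < (a * N + k + 1) * (1 - T N) := by positivity
        refine le_of_mul_le_mul_left ?_ hc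
        rw [hrec]
        have := mul_le_mul_of_nonneg_right hcoef hnn
        linarith
      calc _ = r * (r ^ k * betaTerm ((b + 1) * N) (a * N) 0 (T N)) := by ring
        _ ≤ r * betaTerm ((b + 1) * N) (a * N) k (T N) := by
            gcongr
            exact ih (by omega)
        _ ≤ _ := hr_le
  have hK : betaTerm ((b + 1) * N) (a * N) (N / 2) (T N) ≤ 1 := by
    refine le_trans ?_ (sum_betaTerm_le_one ha hb hN hbN hTN)
    refine Finset.single_le_sum (f := fun k => betaTerm ((b + 1) * N) (a * N) k (T N))
      (fun k hk => ?_) (Finset.mem_range.mpr (by omega))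
    exact betaTerm_nonneg hL (hlt k (by have := Finset.mem_range.mp hk; omega)) hTN
  have h0 : 0 ≤ betaTerm ((b + 1) * N) (a * N) 0 (T N) :=
    betaTerm_nonneg hL (hlt 0 (by omega)) hTN
  have hfin : betaTerm ((b + 1) * N) (a * N) 0 (T N) ≤ (r⁻¹) ^ (N / 2) := by
    have hrk : 0 < r ^ (N / 2) := by positivity
    rw [inv_pow, inv_eq_one_div, le_div_iff₀ hrk, mul_comm]
    exact (hstep _ le_rfl).trans hK
  have hN2 : (N : ℝ) ≤ 2 * ((N / 2 : ℕ) : ℝ) + 1 := by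
    have : N ≤ 2 * (N / 2) + 1 := by omega
    exact_mod_cast this
  rw [Real.norm_of_nonneg (by positivity)]
  gcongr

lemma coeff_mul_pow_mul_weight {n L x : ℝ} (hx : 0 < x) (k : ℕ) :
    betaCoeff n L k * x ^ k * (x ^ L * (1 + x) ^ (-(n + L + 1))) =
      (1 - x / (1 + x)) * betaTerm n L k (x / (1 + x)) := by
  have h1x : 0 < 1 + x := by linarith
  have e : 1 - x / (1 + x) = (1 + x)⁻¹ := by field_simp; ring
  unfold betaTerm
  rw [e, Real.div_rpow hx.le h1x.le, Real.inv_rpow h1x.le, Real.rpow_add_natCast hx.ne',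
    div_eq_mul_inv, ← Real.rpow_neg h1x.le, ← Real.rpow_neg h1x.le]
  have e2 : (1 + x) ^ (-(n + L + 1)) =
      (1 + x) ^ (-(L + k)) * (1 + x) ^ (-(n - k)) * (1 + x)⁻¹ := by
    rw [← Real.rpow_neg_one, ← Real.rpow_add h1x, ← Real.rpow_add h1x]
    congr 1; ring
  rw [e2]
  ring

lemma qS_mul_weight {n L x : ℝ} (hx : 0 < x) (N : ℕ) :
    qS n L N x * (x ^ L * (1 + x) ^ (-(n + L + 1))) =
      (1 - x / (1 + x)) * ∑ k ∈ Finset.range (N + 1), betaTerm n L k (x / (1 + x)) := by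
  rw [qS, Finset.sum_mul, Finset.mul_sum]
  exact Finset.sum_congr rfl fun k _ => coeff_mul_pow_mul_weight hx k

lemma Gamma_div_eq_mul_betaCoeff_zero (n L : ℝ) :
    Real.Gamma (L + n + 1) / (Real.Gamma (n + 1) * Real.Gamma L) = L * betaCoeff n L 0 := by
  unfold betaCoeff
  rcases eq_or_ne L 0 with rfl | hL
  · simp
  · rw [Nat.cast_zero, zero_add, sub_zero, Real.Gamma_add_one hL]
    field_simp

/-- The weighted overlap prefactor in terms of generalised binomial weights. -/
lemma ghat_mul_weight {n L x : ℝ} (hL : 0 ≤ L) {N : ℕ} (hN : N < n) (hx : 0 < x) {T : ℝ}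
    (hT : T = x / (1 + x)) :
    ghat n L N x * (x ^ L * (1 + x) ^ (-(n + L + 1))) =
      (n - N) * T * betaTerm n L N T + ((L + N + 1) * (1 - T) - T * (n - N - 1)) *
        (∑ k ∈ Finset.range (N + 1), betaTerm n L k T + L * betaTerm n L 0 T / (n * x - L)) := by
  have h1x : 0 < 1 + x := by linarith
  have hTm : T ∈ Set.Ioo (0 : ℝ) 1 := by
    rw [hT]
    exact ⟨by positivity, by rw [div_lt_one h1x]; linarith⟩
  have hxT : x * (1 - T) = T := by rw [hT]; field_simp; ring
  have hq := qS_mul_weight (n := n) (L := L) hx N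
  have hq1 := qS_mul_weight (n := n) (L := L) hx (N + 1)
  have h0 := coeff_mul_pow_mul_weight (n := n) (L := L) hx 0
  rw [← hT] at hq hq1 h0
  rw [Finset.sum_range_succ] at hq1
  have hrec := betaTerm_succ hL hN hTm
  unfold ghat qhat
  rw [Gamma_div_eq_mul_betaCoeff_zero]
  rw [pow_zero, mul_one] at h0
  set w := x ^ L * (1 + x) ^ (-(n + L + 1))
  set S := ∑ k ∈ Finset.range (N + 1), betaTerm n L k T
  simp only [div_eq_mul_inv, one_mul]
  linear_combination (L + N + 1) * hq1 - x * (n - N - 1) * hq +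
    ((L + N + 1) - x * (n - N - 1)) * (n * x - L)⁻¹ * L * h0 + hrec
    - (n - N - 1) * (S + (n * x - L)⁻¹ * L * betaTerm n L 0 T) * hxT

lemma tendsto_weighted_ghat {a b : ℝ} (ha : 0 ≤ a) (hb : 0 < b) {x : ℕ → ℝ} {s₀ : ℝ}
    (hx : Tendsto x atTop (nhds ((a + 1) / b)))
    (hs : Tendsto (fun N : ℕ => √(N : ℝ) * (x N / (1 + x N) - edgePt (a + 1) b) /
      edgeScale (a + 1) b) atTop (nhds s₀)) :
    Tendsto (fun N : ℕ => (√(N : ℝ))⁻¹ * (ghat ((b + 1) * N) (a * N) N (x N) *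
      (x N ^ (a * N) * (1 + x N) ^ (-((b + 1) * N + a * N + 1))))) atTop
      (nhds (edgePt (a + 1) b * (1 - edgePt (a + 1) b) *
          (Real.exp (-s₀ ^ 2) / (edgeScale (a + 1) b * √Real.pi)) -
        (a + 1 + b) * edgeScale (a + 1) b * s₀ *
          ((∫ u in Set.Ioi s₀, Real.exp (-u ^ 2)) / √Real.pi))) := by
  have hA : 0 < a + 1 := by linarith
  obtain ⟨h0, h1⟩ := edgePt_mem hA hb
  have hτ := edgeScale_pos hA hb
  have hx0 : 0 < (a + 1) / b := by positivity
  have hπ : √Real.pi ≠ 0 := (Real.sqrt_pos.mpr Real.pi_pos).ne'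
  set t₀ := edgePt (a + 1) b with ht₀
  set τ := edgeScale (a + 1) b with hτdef
  set T : ℕ → ℝ := fun N => x N / (1 + x N) with hTdef
  set s : ℕ → ℝ := fun N => √(N : ℝ) * (T N - t₀) / τ with hsdef
  have hs' : Tendsto s atTop (nhds s₀) := hs
  have hT : Tendsto T atTop (nhds t₀) := by
    have h := hx.div (hx.const_add 1) (by positivity)
    have e : (a + 1) / b / (1 + (a + 1) / b) = t₀ := by
      rw [ht₀, edgePt]; field_simp; ring
    rwa [e] at h
  have hinv : Tendsto (fun N : ℕ => (√(N : ℝ))⁻¹) atTop (nhds 0) :=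
    (Real.tendsto_sqrt_atTop.comp tendsto_natCast_atTop_atTop).inv_tendsto_atTop
  have hsmall := tendsto_natCast_mul_betaTerm_zero ha hb hT
  have hI := tendsto_integral_rescaledKernel hA hb
  have hlead := ((hT.mul (hT.const_sub 1)).mul
    ((tendsto_rescaledKernel hA hb hs').div (hI.const_mul τ) (mul_ne_zero hτ.ne' hπ)))
  have hQ := (tendsto_integral_Ioi_rescaledKernel hA hb hs').div hI hπ
  have hR : Tendsto (fun N : ℕ => a * N * betaCoeff ((b + 1) * N) (a * N) 0 *
      ∫ t in T N..1, t ^ (a * N - 1) * (1 - t) ^ ((b + 1) * N)) atTop (nhds 0) := by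
    have hbd := (hsmall.const_mul a).div hT h0.ne'
    rw [mul_zero, zero_div] at hbd
    refine squeeze_zero_norm' ?_ hbd
    have hmode : ∀ᶠ N in atTop, a * (1 - T N) < (b + 1) * T N := by
      refine Tendsto.eventually_lt ((hT.const_sub 1).const_mul a) (hT.const_mul (b + 1)) ?_
      rw [ht₀, one_sub_edgePt hA hb, edgePt, mul_div_assoc', mul_div_assoc']
      gcongr ?_ / _
      nlinarith
    filter_upwards [hmode, hT.eventually (Ioo_mem_nhds h0 h1), eventually_gt_atTop 0]
      with N hmN hTN hN
    have hN0 : (0 : ℝ) < N := by exact_mod_cast hN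
    refine (betaCoeff_zero_mul_integral_le (by positivity) (by positivity) hTN ?_).trans
      (le_of_eq ?_)
    · nlinarith
    · simp only [Pi.div_apply]; ring
  have hE : Tendsto (fun N : ℕ => a * N * betaTerm ((b + 1) * N) (a * N) 0 (T N) /
      ((b + 1) * N * x N - a * N)) atTop (nhds 0) := by
    have hden : (b + 1) * ((a + 1) / b) - a ≠ 0 := by
      have : (b + 1) * ((a + 1) / b) - a = (a + b + 1) / b := by field_simp; ring
      rw [this]; positivity
    have h := ((hsmall.const_mul a).mul tendsto_inv_atTop_nhds_zero_nat).div
      ((hx.const_mul (b + 1)).sub_const a) hden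
    rw [mul_zero a, zero_mul, zero_div] at h
    refine h.congr fun N => ?_
    simp only [Pi.div_apply]
    rw [show (b + 1) * N * x N - a * N = N * ((b + 1) * x N - a) by ring, div_eq_mul_inv,
      div_eq_mul_inv, mul_inv]
    ring
  have hY : Tendsto (fun N : ℕ => (√(N : ℝ))⁻¹ - (a + 1 + b) * τ * s N) atTop
      (nhds (0 - (a + 1 + b) * τ * s₀)) := hinv.sub (hs'.const_mul _)
  have key := hlead.add (hY.mul ((hQ.sub hR).add hE))
  convert key.congr' ?_ using 2
  · ring
  filter_upwards [hx.eventually_const_lt hx0, hT.eventually (Ioo_mem_nhds h0 h1),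
    eventually_gt_atTop 0, eventually_one_le_mul_natCast hb] with N hxN hTN hN hbN
  have hN0 : (0 : ℝ) < N := by exact_mod_cast hN
  have hs0 : 0 < √(N : ℝ) := by positivity
  have hss : √(N : ℝ) * √N = N := Real.mul_self_sqrt hN0.le
  have hL : 0 ≤ a * N := by positivity
  have hT1 : 0 < 1 - T N := by linarith [hTN.2]
  have hpos := integral_rescaledKernel_pos ha hb hN
  have hk := betaKernel_pos (a + 1) b N (edgePt_mem hA hb)
  rw [ghat_mul_weight hL (by linarith) hxN (rfl : T N = x N / (1 + x N)),
    sum_betaTerm_eq_integral hL (by linarith) hTN, mul_betaCoeff_mul_integral ha hb hN hTN]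
  have hterm : ((b + 1) * N - N) * T N * betaTerm ((b + 1) * N) (a * N) N (T N) =
      √N * (T N * (1 - T N) * (rescaledKernel (a + 1) b N (s N) /
        (τ * ∫ y, rescaledKernel (a + 1) b N y))) := by
    have hres : rescaledKernel (a + 1) b N (s N) =
        betaKernel (a + 1) b N (T N) / betaKernel (a + 1) b N t₀ := by
      have e : t₀ + τ / √N * s N = T N := by
        simp only [hsdef]; field_simp; ring
      unfold rescaledKernel
      rw [← ht₀, ← hτdef, e, Set.indicator_of_mem (show T N ∈ Set.Ioo (0 : ℝ) 1 from hTN)]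
    have hbt : betaTerm ((b + 1) * N) (a * N) N (T N) =
        betaCoeff ((b + 1) * N) (a * N) N * (betaKernel (a + 1) b N (T N) * (1 - T N)) := by
      unfold betaTerm betaKernel
      rw [mul_assoc ((T N) ^ _), ← Real.rpow_add_one hT1.ne']
      congr 3 <;> ring
    have hco := mul_betaCoeff_eq_inv ha hb hN
    rw [integral_betaKernel hA hb hN, ← ht₀, ← hτdef] at hco
    calc _ = (b * N * betaCoeff ((b + 1) * N) (a * N) N) *
          (T N * (1 - T N) * betaKernel (a + 1) b N (T N)) := by rw [hbt]; ring
      _ = _ := by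
        rw [hco, hres]
        field_simp
  have hcoef : (a * N + N + 1) * (1 - T N) - T N * ((b + 1) * N - N - 1) =
      √N * ((√(N : ℝ))⁻¹ - (a + 1 + b) * τ * s N) := by
    have e1 : τ * s N = √N * (T N - t₀) := by simp only [hsdef]; field_simp
    have e2 : (a + 1 + b) * t₀ = a + 1 := by rw [ht₀, edgePt]; field_simp
    rw [mul_sub √(N : ℝ), mul_inv_cancel₀ hs0.ne', mul_assoc (a + 1 + b), e1]
    linear_combination (a + 1 + b) * (T N - t₀) * hss - N * e2
  rw [hterm, hcoef]
  simp only [Pi.div_apply]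
  rw [mul_assoc (√(N : ℝ)) ((√(N : ℝ))⁻¹ - _), ← mul_add, inv_mul_cancel_left₀ hs0.ne']

lemma edgeScale_eq {A b : ℝ} (hA : 0 < A) (hb : 0 < b) :
    edgeScale A b = √2 * √(A * b) / ((A + b) * √(A + b)) := by
  have hD : 0 < A + b := by linarith
  have e : 2 * A * b / (A + b) ^ 3 = 2 * (A * b) / ((A + b) ^ 2 * (A + b)) := by ring
  unfold edgeScale
  rw [e, Real.sqrt_div (by positivity), Real.sqrt_mul zero_le_two,
    Real.sqrt_mul (sq_nonneg (A + b)), Real.sqrt_sq hD.le]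

lemma edge_limit_eq {A b : ℝ} (hA : 0 < A) (hb : 0 < b) (χ : ℝ) :
    edgePt A b * (1 - edgePt A b) *
          (Real.exp (-(√2 * χ) ^ 2) / (edgeScale A b * √Real.pi)) -
        (A + b) * edgeScale A b * (√2 * χ) *
          ((∫ u in Set.Ioi (√2 * χ), Real.exp (-u ^ 2)) / √Real.pi) =
      √(A * b / (2 * Real.pi * (A + b))) * calF (2 * χ) := by
  have hD : 0 < A + b := by linarith
  have h2 : √(2 : ℝ) ^ 2 = 2 := Real.sq_sqrt (by norm_num)
  have hq : √(A * b) ^ 2 = A * b := Real.sq_sqrt (by positivity)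
  have hr : √(A + b) ^ 2 = A + b := Real.sq_sqrt hD.le
  have h2p : 0 < √(2 : ℝ) := by positivity
  have hqp : 0 < √(A * b) := by positivity
  have hrp : 0 < √(A + b) := by positivity
  have hπp : 0 < √Real.pi := Real.sqrt_pos.mpr Real.pi_pos
  have hτ := edgeScale_eq hA hb
  have hc : √(A * b / (2 * Real.pi * (A + b))) = √(A * b) / (√2 * √Real.pi * √(A + b)) := by
    rw [Real.sqrt_div (by positivity), Real.sqrt_mul Real.two_pi_pos.le, Real.sqrt_mul zero_le_two]
  have hs : 2 * χ / √2 = √2 * χ := by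
    rw [div_eq_iff h2p.ne']; linear_combination -χ * h2
  have he : -(2 * χ) ^ 2 / 2 = -(√2 * χ) ^ 2 := by rw [mul_pow √2, h2]; ring
  rw [one_sub_edgePt hA hb, calF, Ferfc, erfc, hs, hc, hτ, he, Real.sqrt_mul zero_le_two]
  set E := Real.exp (-(√2 * χ) ^ 2)
  set J := ∫ u in Set.Ioi (√2 * χ), Real.exp (-u ^ 2)
  unfold edgePt
  generalize √(2 : ℝ) = z at *
  generalize √Real.pi = w at *
  generalize √(A * b) = q at *
  generalize hrr : √(A + b) = r at *
  have e1 : A / (A + b) * (b / (A + b)) = q ^ 2 / r ^ 4 := by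
    rw [hq, show r ^ 4 = (r ^ 2) ^ 2 by ring, hr]; field_simp
  rw [e1, ← hr]
  field_simp
  linear_combination (-z * χ * J) * h2

lemma tendsto_edge_parameter {A b : ℝ} (hA : 0 < A) (hb : 0 < b) (χ : ℝ) {lam : ℕ → ℝ}
    (hlam : ∀ᶠ N : ℕ in atTop,
      lam N = √(A / b) + χ * (1 + A / b) / √((A + b) * N + 1)) :
    Tendsto lam atTop (nhds √(A / b)) ∧
    Tendsto (fun N : ℕ => √(N : ℝ) * (lam N ^ 2 / (1 + lam N ^ 2) - edgePt A b) /
      edgeScale A b) atTop (nhds (√2 * χ)) := by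
  have hD : 0 < A + b := by linarith
  have hp2 : √(A / b) ^ 2 = A / b := Real.sq_sqrt (by positivity)
  set p := √(A / b) with hp
  have hτ := edgeScale_pos hA hb
  have hlin : Tendsto (fun N : ℕ => (A + b) * (N : ℝ) + 1) atTop atTop :=
    tendsto_atTop_add_const_right _ _ (tendsto_natCast_atTop_atTop.const_mul_atTop hD)
  have hd0 : Tendsto (fun N : ℕ => χ * (1 + A / b) / √((A + b) * N + 1)) atTop (nhds 0) :=
    (Real.tendsto_sqrt_atTop.comp hlin).const_div_atTop _
  have hl : Tendsto lam atTop (nhds p) := by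
    have h := hd0.const_add p
    rw [add_zero] at h
    exact h.congr' (hlam.mono fun N h => h.symm)
  refine ⟨hl, ?_⟩
  have hratio : Tendsto (fun N : ℕ => √(N : ℝ) / √((A + b) * N + 1)) atTop
      (nhds (√(1 / (A + b)))) := by
    have h : Tendsto (fun N : ℕ => (1 : ℝ) / (A + b + (N : ℝ)⁻¹)) atTop
        (nhds (1 / (A + b + 0))) :=
      tendsto_const_nhds.div (tendsto_inv_atTop_nhds_zero_nat.const_add _) (by positivity)
    rw [add_zero] at h
    refine h.sqrt.congr' ?_
    filter_upwards [eventually_gt_atTop 0] with N hN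
    have hN0 : (0 : ℝ) < N := by exact_mod_cast hN
    rw [← Real.sqrt_div hN0.le]
    congr 1
    field_simp
  have hmain := (((hratio.const_mul (χ * (1 + A / b))).mul (hl.add_const p)).div
    ((hl.pow 2).const_add 1) (by positivity)).div_const ((1 + A / b) * edgeScale A b)
  have hlim : χ * (1 + A / b) * √(1 / (A + b)) * (p + p) / (1 + p ^ 2) /
      ((1 + A / b) * edgeScale A b) = √2 * χ := by
    have hpe : p = √(A * b) / b := by
      rw [hp, Real.sqrt_eq_iff_eq_sq (by positivity) (by positivity), div_pow,
        Real.sq_sqrt (by positivity)]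
      field_simp
    have hsc := edgeScale_eq hA hb
    have h2 : √(2 : ℝ) ^ 2 = 2 := Real.sq_sqrt (by norm_num)
    have hqp : 0 < √(A * b) := by positivity
    have hrp : 0 < √(A + b) := by positivity
    rw [hp2, hpe, hsc, Real.sqrt_div zero_le_one, Real.sqrt_one,
      show 1 + A / b = (A + b) / b by field_simp; ring]
    field_simp
    linear_combination -χ * h2
  rw [hlim] at hmain
  refine hmain.congr' ?_
  filter_upwards [hlam] with N hN
  have hl2 : 0 < 1 + lam N ^ 2 := by positivity
  have hNr : 0 < √((A + b) * (N : ℝ) + 1) := by positivity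
  have e1 : lam N ^ 2 / (1 + lam N ^ 2) - edgePt A b =
      (lam N - p) * (lam N + p) / ((1 + lam N ^ 2) * (1 + A / b)) := by
    rw [show (lam N - p) * (lam N + p) = lam N ^ 2 - A / b by rw [← hp2]; ring]
    unfold edgePt
    field_simp
    ring
  have e2 : lam N - p = χ * (1 + A / b) / √((A + b) * N + 1) := by rw [hN]; ring
  simp only [Pi.div_apply]
  rw [e1, e2]
  field_simp

/-- Outer-edge asymptotics, in the strongly non-unitary regime, of the on-diagonal
overlap prefactor `ĝ_N · ω̂` of the induced spherical unitary ensemble. -/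
theorem ghat_outer_edge_asymptotics (a b : ℝ) (ha : 0 ≤ a) (hb : 0 < b) (χ : ℝ) :
    Tendsto (fun N : ℕ =>
      let p : ℝ := Real.sqrt ((a + 1) / b)
      let LN : ℝ := a * N
      let nN : ℝ := (b + 1) * N
      let δN : ℝ := (nN + LN + 1) / (N * (1 + p ^ 2) ^ 2)
      let lamN : ℝ := p + χ / Real.sqrt (N * δN)
      (N : ℝ) ^ (-(1 : ℝ) / 2) * ghat nN LN N (lamN ^ 2) * lamN ^ (2 * LN) *
        (1 + lamN ^ 2) ^ (-(nN + LN + 1)))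
      atTop
      (nhds (Real.sqrt ((a + 1) * b / (2 * Real.pi * (a + b + 1))) * calF (2 * χ))) := by
  have hA : 0 < a + 1 := by linarith
  have hD : 0 < a + 1 + b := by linarith
  have hp : 0 < √((a + 1) / b) := by positivity
  have hp2 : √((a + 1) / b) ^ 2 = (a + 1) / b := Real.sq_sqrt (by positivity)
  set lam : ℕ → ℝ := fun N => √((a + 1) / b) + χ / √(N *
    (((b + 1) * N + a * N + 1) / (N * (1 + √((a + 1) / b) ^ 2) ^ 2))) with hlamdef
  have hlam : ∀ᶠ N : ℕ in atTop,
      lam N = √((a + 1) / b) + χ * (1 + (a + 1) / b) / √((a + 1 + b) * N + 1) := by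
    filter_upwards [eventually_gt_atTop 0] with N hN
    have hN0 : (0 : ℝ) < N := by exact_mod_cast hN
    simp only [hlamdef]
    congr 1
    have e : (N : ℝ) * (((b + 1) * N + a * N + 1) / (N * (1 + √((a + 1) / b) ^ 2) ^ 2)) =
        ((a + 1 + b) * N + 1) / (1 + (a + 1) / b) ^ 2 := by
      rw [hp2, show (b + 1) * N + a * N + 1 = (a + 1 + b) * (N : ℝ) + 1 by ring]
      generalize (1 + (a + 1) / b) ^ 2 = y
      rw [mul_div_assoc', mul_div_mul_left _ _ hN0.ne']
    rw [e, Real.sqrt_div (by positivity), Real.sqrt_sq (by positivity), div_div_eq_mul_div]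
  obtain ⟨hl, hs⟩ := tendsto_edge_parameter hA hb χ hlam
  have hx : Tendsto (fun N => lam N ^ 2) atTop (nhds ((a + 1) / b)) := by
    rw [← hp2]; exact hl.pow 2
  have h := tendsto_weighted_ghat ha hb hx hs
  rw [edge_limit_eq hA hb χ, show a + 1 + b = a + b + 1 by ring] at h
  refine h.congr' ?_
  filter_upwards [hl.eventually_const_lt hp, eventually_gt_atTop 0] with N hlN hN
  have hN0 : (0 : ℝ) ≤ N := by positivity
  have e1 : (N : ℝ) ^ (-(1 : ℝ) / 2) = (√(N : ℝ))⁻¹ := by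
    rw [neg_div, Real.rpow_neg hN0, Real.sqrt_eq_rpow]
  have e2 : lam N ^ (2 * (a * N)) = (lam N ^ 2) ^ (a * N) := by
    rw [Real.rpow_mul hlN.le, Real.rpow_two]
  change _ = (N : ℝ) ^ (-(1 : ℝ) / 2) * ghat ((b + 1) * N) (a * N) N (lam N ^ 2) *
    lam N ^ (2 * (a * N)) * (1 + lam N ^ 2) ^ (-((b + 1) * N + a * N + 1))
  rw [e1, e2]
  ring
end
end
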